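/- Let S be a maximal star decomposition of a cyclic polygon P(V,E) and let uv be a minimal edge of E. Then S can be transformed by a finite sequence of diagonal flips into a maximal star decomposition S* of P that contains the border star S*(P,v) as one of its stars. -/

import Mathlib

open Complex
open scoped Classical

noncomputable section

/-- The anticlockwise arc displacement from `u` to `v` on the unit circle, lying in `(0, 2π]`
(equal to `2π` when `v = u`). -/
def posArc (u v : ℂ) : ℝ :=
  if 0 < Complex.arg (v / u) then Complex.arg (v / u) else Complex.arg (v / u) + 2 * Real.pi

/-- `u, v, w` occur in anticlockwise order on the circle. -/
def ACW (u v w : ℂ) : Prop :=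
  u ≠ v ∧ v ≠ w ∧ u ≠ w ∧ posArc u v < posArc u w

/-- The open anticlockwise arc from `u` to `v`. -/
def arcOO (u v : ℂ) : Set ℂ := {x | x ≠ u ∧ x ≠ v ∧ posArc u x < posArc u v}

/-- The anticlockwise arc from `u` to `v`, open at `u` and closed at `v`. -/
def arcOC (u v : ℂ) : Set ℂ := {x | x ≠ u ∧ (x = v ∨ posArc u x < posArc u v)}

/-- The closed anticlockwise arc from `u` to `v`. -/
def arcCC (u v : ℂ) : Set ℂ := {x | x = u ∨ x = v ∨ (x ≠ u ∧ posArc u x < posArc u v)}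

/-- The (undirected) angle `∠ x v z` at apex `v`. -/
def vangle (x v z : ℂ) : ℝ := |Complex.arg ((x - v) / (z - v))|

/-- A cyclic polygon: a finite set of vertices on the unit circle together with a set of
directed edges such that every vertex has indegree and outdegree one, and any two
consecutive edges `uv`, `vw` have `u, v, w` in anticlockwise order. -/
structure CyclicPolygon where
  V : Finset ℂ
  E : Finset (ℂ × ℂ)
  nonempty : V.Nonempty
  onCircle : ∀ v ∈ V, ‖v‖ = 1
  endmem : ∀ e ∈ E, e.1 ∈ V ∧ e.2 ∈ V
  outdeg : ∀ v ∈ V, ∃! w, (v, w) ∈ E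
  indeg : ∀ v ∈ V, ∃! u, (u, v) ∈ E
  acw : ∀ u v w : ℂ, (u, v) ∈ E → (v, w) ∈ E → ACW u v w

namespace CyclicPolygon

/-- The successor `v⁺` of a vertex. -/
noncomputable def next (P : CyclicPolygon) (v : ℂ) : ℂ :=
  if h : ∃ w, (v, w) ∈ P.E then h.choose else v

/-- The predecessor `v⁻` of a vertex. -/
noncomputable def prev (P : CyclicPolygon) (v : ℂ) : ℂ :=
  if h : ∃ u, (u, v) ∈ P.E then h.choose else v

end CyclicPolygon

/-- The interior angle `∠ v⁻ v v⁺` of `P` at `v`. -/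
def interiorAngle (P : CyclicPolygon) (v : ℂ) : ℝ :=
  vangle (P.prev v) v (P.next v)

/-- The length of an edge `uv`: the number of vertices on the open anticlockwise
arc from `u` to `v`, plus one. -/
def edgeLength (P : CyclicPolygon) (u v : ℂ) : ℕ :=
  ((P.V : Set ℂ) ∩ arcOO u v).ncard + 1

/-- A `k`-star: a cyclic polygon with `2k+1` vertices all of whose edges have length `k`. -/
def IsKStar (S : CyclicPolygon) (k : ℕ) : Prop :=
  S.V.card = 2 * k + 1 ∧ ∀ e ∈ S.E, edgeLength S e.1 e.2 = k

/-- A star: a `k`-star for some positive integer `k`. -/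
def IsStar (S : CyclicPolygon) : Prop := ∃ k : ℕ, 0 < k ∧ IsKStar S k

/-- The segment from `u` to `x` splits the interior angle `∠ u⁻ u u⁺` of `S` at `u`
into the two (smaller, nonzero) angles `∠ u⁻ u x` and `∠ x u u⁺`. -/
def SplitsVertexAngle (S : CyclicPolygon) (u x : ℂ) : Prop :=
  u ∈ S.V ∧ 0 < vangle (S.prev u) u x ∧ 0 < vangle x u (S.next u) ∧
    vangle (S.prev u) u x + vangle x u (S.next u) = vangle (S.prev u) u (S.next u)

/-- `(u, v)` is a linkable pair for the pair of cyclic polygons `(S₁, S₂)`: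
the segment `uv` splits the angle of `S₁` at `u` and the angle of `S₂` at `v`. -/
def LinkablePair (S₁ S₂ : CyclicPolygon) (u v : ℂ) : Prop :=
  u ≠ v ∧ SplitsVertexAngle S₁ u v ∧ SplitsVertexAngle S₂ v u

/-- `u, v` is a linkable pair of vertices of the cyclic polygon `P`. -/
def Linkable (P : CyclicPolygon) (u v : ℂ) : Prop := LinkablePair P P u v

/-- `D` is a set of (undirected) diagonals of `P`, i.e. every member joins a linkable pair. -/
def IsDiagonalSet (P : CyclicPolygon) (D : Set (Sym2 ℂ)) : Prop :=
  ∀ u v : ℂ, s(u, v) ∈ D → Linkable P u v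

/-- The set `D̃` of directed edges associated to a set of diagonals `D`. -/
def tilde (D : Set (Sym2 ℂ)) : Set (ℂ × ℂ) := {e | s(e.1, e.2) ∈ D}

/-- The segment from `v` towards `x` splits the angle `∠ u v w`. -/
def SplitsAngle3 (u v w x : ℂ) : Prop :=
  0 < vangle u v x ∧ 0 < vangle x v w ∧ vangle u v x + vangle x v w = vangle u v w

/-- `𝒮` is a star decomposition of `P` with respect to the diagonal set `D`: the
cycle decomposition of `E ∪ D̃` determined by `f_next` (each cycle follows the
tightest turn, i.e. no diagonal of `D` splits the angle between two consecutive
edges of a cycle), all of whose cycles are stars. -/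
def IsStarDecomp (P : CyclicPolygon) (D : Set (Sym2 ℂ)) (𝒮 : Finset CyclicPolygon) : Prop :=
  IsDiagonalSet P D ∧
  (∀ S ∈ 𝒮, IsStar S ∧ (S.V : Set ℂ) ⊆ (P.V : Set ℂ)) ∧
  (∀ S ∈ 𝒮, (S.E : Set (ℂ × ℂ)) ⊆ (P.E : Set (ℂ × ℂ)) ∪ tilde D) ∧
  (∀ e ∈ (P.E : Set (ℂ × ℂ)) ∪ tilde D, ∃ S ∈ 𝒮, e ∈ S.E) ∧
  (∀ S₁ ∈ 𝒮, ∀ S₂ ∈ 𝒮, S₁ ≠ S₂ → ∀ e : ℂ × ℂ, e ∈ S₁.E → e ∉ S₂.E) ∧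
  (∀ S ∈ 𝒮, ∀ u v w : ℂ, (u, v) ∈ S.E → (v, w) ∈ S.E →
      ¬ ∃ x, s(v, x) ∈ D ∧ SplitsAngle3 u v w x)

/-- `P` admits a star decomposition with respect to `D`. -/
def HasStarDecomp (P : CyclicPolygon) (D : Set (Sym2 ℂ)) : Prop :=
  ∃ 𝒮 : Finset CyclicPolygon, IsStarDecomp P D 𝒮

/-- A maximal star decomposition: no proper superset of `D` admits a star decomposition. -/
def IsMaximalStarDecomp (P : CyclicPolygon) (D : Set (Sym2 ℂ))
    (𝒮 : Finset CyclicPolygon) : Prop :=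
  IsStarDecomp P D 𝒮 ∧ ∀ D' : Set (Sym2 ℂ), D ⊂ D' → ¬ HasStarDecomp P D'

/-- `D'` is obtained from `D` by a diagonal flip: remove one diagonal and add another. -/
def FlipStep (D D' : Set (Sym2 ℂ)) : Prop :=
  ∃ e f : Sym2 ℂ, e ∈ D ∧ f ∉ D ∧ D' = (D \ {e}) ∪ {f}

/-- The two chords `ab` and `cd` are crossing: they share no endpoint and
intersect inside the circle. -/
def Crossing (a b c d : ℂ) : Prop :=
  a ≠ c ∧ a ≠ d ∧ b ≠ c ∧ b ≠ d ∧ (openSegment ℝ a b ∩ openSegment ℝ c d).Nonempty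

/-- The two chords `ab` and `cd` share a common point: they have a common
endvertex or intersect inside the circle. -/
def ShareCommonPoint (a b c d : ℂ) : Prop :=
  a = c ∨ a = d ∨ b = c ∨ b = d ∨ (openSegment ℝ a b ∩ openSegment ℝ c d).Nonempty

/-- Two cyclic polygons have a pair of overlapped angles: a common vertex `y` and a vertex
`x` of either polygon lying on both arcs `⦅y⁺ y⁻⟧` (taken in each polygon). -/
def OverlappedAngles (S₁ S₂ : CyclicPolygon) : Prop :=
  ∃ y : ℂ, y ∈ S₁.V ∧ y ∈ S₂.V ∧
    ∃ x : ℂ, (x ∈ S₁.V ∨ x ∈ S₂.V) ∧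
      x ∈ arcOC (S₁.next y) (S₁.prev y) ∧ x ∈ arcOC (S₂.next y) (S₂.prev y)

/-- Two cyclic polygons are mutually independent: no two of their angles are overlapped. -/
def IndepPolygons (S₁ S₂ : CyclicPolygon) : Prop := ¬ OverlappedAngles S₁ S₂

/-- The edge `uv` of `P` is minimal: no edge `xy` of `P` has all vertices of the closed
arc from `x` to `y` inside the open arc from `u` to `v`. -/
def MinimalEdge (P : CyclicPolygon) (u v : ℂ) : Prop :=
  (u, v) ∈ P.E ∧
    ¬ ∃ x y : ℂ, (x, y) ∈ P.E ∧ ∀ z ∈ P.V, z ∈ arcCC x y → z ∈ arcOO u v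

/-- `vs` enumerates the star `S` as `v₀ v₁ ⋯ v₂ₖ` with `v₁ = v`, `v₀ = v⁻` (so that `v⁻v`
is an edge of `S`), each edge of `S` is an edge of `P` or a diagonal of `P`, and all the
edges `v₂ᵢ₋₁v₂ᵢ` are edges of `P`. -/
def IsBorderCandidate (P : CyclicPolygon) (v : ℂ) (S : CyclicPolygon) (k : ℕ)
    (vs : ℕ → ℂ) : Prop :=
  0 < k ∧ IsStar S ∧ S.V.card = 2 * k + 1 ∧
  (S.V : Set ℂ) ⊆ (P.V : Set ℂ) ∧
  vs 0 = P.prev v ∧ vs 1 = v ∧ vs (2 * k + 1) = vs 0 ∧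
  (∀ x ∈ S.V, ∃ i ≤ 2 * k, vs i = x) ∧
  (∀ i ≤ 2 * k, (vs i, vs (i + 1)) ∈ S.E) ∧
  (∀ i ≤ 2 * k, (vs i, vs (i + 1)) ∈ P.E ∨ Linkable P (vs i) (vs (i + 1))) ∧
  (∀ i : ℕ, 1 ≤ i → i ≤ k → (vs (2 * i - 1), vs (2 * i)) ∈ P.E)

/-- The angle sequence `(∠v₁v₂v₃, ∠v₃v₄v₅, …, ∠v₂ₖ₋₁v₂ₖv₀)` of an enumerated star. -/
noncomputable def angleList (vs : ℕ → ℂ) (k : ℕ) : List ℝ :=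
  (List.range k).map fun i => vangle (vs (2 * i + 1)) (vs (2 * i + 2)) (vs (2 * i + 3))

/-- `S` is the border star `S*(P, v)`: among all border candidates, its angle sequence is
lexicographically minimal. -/
def IsBorderStar (P : CyclicPolygon) (v : ℂ) (S : CyclicPolygon) : Prop :=
  ∃ (k : ℕ) (vs : ℕ → ℂ), IsBorderCandidate P v S k vs ∧
    ∀ (S' : CyclicPolygon) (k' : ℕ) (vs' : ℕ → ℂ), IsBorderCandidate P v S' k' vs' →
      ¬ List.Lex (· < ·) (angleList vs' k') (angleList vs k)


/-! ### Combinatorial core: pipes in the lattice -/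

lemma perm_apply_inv {α : Type*} (f : Equiv.Perm α) (x : α) : f (f⁻¹ x) = x :=
  f.apply_symm_apply x

/-- Cyclic polygon in index form. -/
structure PNet where
  n : ℕ
  nx : ℤ → ℤ
  pv : ℤ → ℤ
  nx_pv : ∀ i, nx (pv i) = i
  pv_nx : ∀ i, pv (nx i) = i
  lt_nx : ∀ i, i < nx i
  acw : ∀ i, nx i < pv i + n
  nx_add : ∀ i, nx (i + n) = nx i + n

/-- A unit step of a pipe: starting lattice point and direction (`true` = left). -/
@[ext] structure PSt where
  a : ℤ
  b : ℤ
  d : Bool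

namespace PSt
def time (x : PSt) : ℤ := x.a + x.b
def key (x : PSt) : ℤ := 2 * (x.b - x.a) + (if x.d then 1 else -1)
def pos (x : PSt) : ℤ × ℤ := (x.a, x.b)

lemma eq_of_key {x y : PSt} (ht : x.time = y.time) (hk : x.key = y.key) : x = y := by
  obtain ⟨a, b, d⟩ := x
  obtain ⟨a', b', d'⟩ := y
  simp only [time, key] at *
  cases d <;> cases d' <;> simp at * <;> omega

lemma dir_ne {x y : PSt} (h : x ≠ y) (hp : x.pos = y.pos) : y.d = !x.d := by
  obtain ⟨a, b, d⟩ := x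
  obtain ⟨a', b', d'⟩ := y
  simp only [pos, Prod.mk.injEq] at *
  cases d <;> cases d' <;> simp_all
end PSt

namespace PNet
variable (N : PNet)

lemma pv_lt (i : ℤ) : N.pv i < i := by
  have := N.lt_nx (N.pv i); rw [N.nx_pv] at this; exact this

lemma npos : 0 < (N.n : ℤ) := by
  have h1 := N.acw 0
  have h2 := N.lt_nx 0
  have h3 := N.pv_lt 0
  omega

lemma pv_add (i : ℤ) : N.pv (i + N.n) = N.pv i + N.n := by
  have h := N.nx_add (N.pv i)
  rw [N.nx_pv] at h
  rw [← h, N.pv_nx]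

lemma nx_sub (i : ℤ) : N.nx (i - N.n) = N.nx i - N.n := by
  have h := N.nx_add (i - N.n)
  rw [sub_add_cancel] at h; omega

lemma pv_sub (i : ℤ) : N.pv (i - N.n) = N.pv i - N.n := by
  have h := N.pv_add (i - N.n)
  rw [sub_add_cancel] at h; omega

lemma eq_nx_iff {a b : ℤ} : b = N.nx a ↔ a = N.pv b :=
  ⟨fun h => by rw [h, N.pv_nx], fun h => by rw [h, N.nx_pv]⟩

lemma eq_pv_iff {a b : ℤ} : b = N.pv a + N.n ↔ N.nx b = a + N.n := by
  rw [← N.pv_add]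
  constructor
  · intro h; rw [h, N.nx_pv]
  · intro h; rw [← h, N.pv_nx]

/-- linkable lattice points -/
def L : Set (ℤ × ℤ) := {p | N.nx p.1 < p.2 ∧ p.2 < N.pv p.1 + N.n ∧
  N.nx p.2 < p.1 + N.n ∧ p.1 < N.pv p.2}

/-- glide reflection on points -/
def gp : Equiv.Perm (ℤ × ℤ) where
  toFun p := (p.2 - N.n, p.1)
  invFun p := (p.2, p.1 + N.n)
  left_inv p := by simp
  right_inv p := by simp

@[simp] lemma gp_apply (p : ℤ × ℤ) : N.gp p = (p.2 - N.n, p.1) := rfl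

/-- glide reflection on steps -/
def g : Equiv.Perm PSt where
  toFun x := ⟨x.b - N.n, x.a, !x.d⟩
  invFun x := ⟨x.b, x.a + N.n, !x.d⟩
  left_inv x := by ext <;> simp
  right_inv x := by ext <;> simp

@[simp] lemma g_a (x : PSt) : (N.g x).a = x.b - N.n := rfl
@[simp] lemma g_b (x : PSt) : (N.g x).b = x.a := rfl
@[simp] lemma g_d (x : PSt) : (N.g x).d = !x.d := rfl

lemma key_g (x : PSt) : (N.g x).key = 2 * N.n - x.key := by
  obtain ⟨a, b, d⟩ := x
  simp only [PSt.key, g_a, g_b, g_d]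
  cases d <;> simp <;> ring

lemma time_g (x : PSt) : (N.g x).time = x.time - N.n := by
  simp [PSt.time]; ring

lemma sum_gp_zpow (m : ℤ) (p : ℤ × ℤ) :
    ((N.gp ^ m) p).1 + ((N.gp ^ m) p).2 = p.1 + p.2 - m * N.n := by
  have h1 : ∀ p : ℤ × ℤ, (N.gp p).1 + (N.gp p).2 = p.1 + p.2 - N.n := by
    intro p; simp; ring
  induction m using Int.induction_on generalizing p with
  | zero => simp
  | succ m ih => rw [zpow_add_one, Equiv.Perm.mul_apply, ih, h1]; ring
  | pred m ih =>
    rw [zpow_sub_one, Equiv.Perm.mul_apply, ih]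
    have := h1 (N.gp⁻¹ p)
    rw [perm_apply_inv] at this
    linarith

structure Valid (D : Set (ℤ × ℤ)) : Prop where
  sub : D ⊆ N.L
  inv : ∀ p, N.gp p ∈ D ↔ p ∈ D

lemma L_inv (p : ℤ × ℤ) : N.gp p ∈ N.L ↔ p ∈ N.L := by
  obtain ⟨a, b⟩ := p
  simp only [L, Set.mem_ofPred_eq, gp_apply, N.nx_sub, N.pv_sub]
  omega

lemma inv_zpow {D : Set (ℤ × ℤ)} (h : ∀ p, N.gp p ∈ D ↔ p ∈ D) (m : ℤ) (p : ℤ × ℤ) :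
    (N.gp ^ m) p ∈ D ↔ p ∈ D := by
  induction m using Int.induction_on generalizing p with
  | zero => simp
  | succ m ih => rw [zpow_add_one, Equiv.Perm.mul_apply, ih, h]
  | pred m ih =>
    rw [zpow_sub_one, Equiv.Perm.mul_apply, ih]
    have := h (N.gp⁻¹ p)
    rw [perm_apply_inv] at this
    exact this.symm

/-- turning points -/
def K (D : Set (ℤ × ℤ)) : Set (ℤ × ℤ) := {p | p ∈ D ∨ p.2 = N.nx p.1 ∨ p.2 = N.pv p.1 + N.n}

lemma K_inv {D : Set (ℤ × ℤ)} (h : N.Valid D) (p : ℤ × ℤ) : N.gp p ∈ N.K D ↔ p ∈ N.K D := by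
  have h1 := h.inv p
  obtain ⟨a, b⟩ := p
  have e1 := N.eq_nx_iff (a := b - N.n) (b := a)
  have e2 := N.eq_pv_iff (a := b - N.n) (b := a)
  have e3 := N.eq_nx_iff (a := a) (b := b)
  have e4 := N.eq_pv_iff (a := a) (b := b)
  rw [N.nx_sub] at *
  rw [N.pv_sub] at *
  simp only [K, Set.mem_ofPred_eq, gp_apply, N.nx_sub, N.pv_sub] at *
  rw [h1]
  have e5 : a = N.nx b - N.n ↔ b = N.pv a + N.n := by rw [e4]; constructor <;> intro h <;> omega
  have e6 : a = N.pv b - N.n + N.n ↔ b = N.nx a := by rw [e3]; constructor <;> intro h <;> omega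
  rw [e5, e6]
  tauto

/-- validity of a unit step -/
def InX (x : PSt) : Prop :=
  if x.d then N.nx x.b < x.a + N.n ∧ x.a ≤ N.pv x.b else N.nx x.a < x.b ∧ x.b ≤ N.pv x.a + N.n

lemma inX_left {a b : ℤ} : N.InX ⟨a, b, true⟩ ↔ N.nx b < a + N.n ∧ a ≤ N.pv b := by simp [InX]
lemma inX_down {a b : ℤ} : N.InX ⟨a, b, false⟩ ↔ N.nx a < b ∧ b ≤ N.pv a + N.n := by simp [InX]

lemma inX_g {x : PSt} : N.InX (N.g x) ↔ N.InX x := by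
  obtain ⟨a, b, d⟩ := x
  have : N.g ⟨a, b, d⟩ = ⟨b - N.n, a, !d⟩ := rfl
  rw [this]
  cases d
  · simp only [Bool.not_false, inX_left, inX_down]; omega
  · simp only [Bool.not_true, inX_left, inX_down, N.nx_sub, N.pv_sub]; omega

/-- the pipe flow -/
def step (D : Set (ℤ × ℤ)) : Equiv.Perm PSt where
  toFun x :=
    if x.d then ⟨x.a - 1, x.b, if (x.a - 1, x.b) ∈ N.K D then false else true⟩
    else ⟨x.a, x.b - 1, if (x.a, x.b - 1) ∈ N.K D then true else false⟩
  invFun y :=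
    if (if (y.a, y.b) ∈ N.K D then !y.d else y.d) then ⟨y.a + 1, y.b, true⟩
    else ⟨y.a, y.b + 1, false⟩
  left_inv x := by
    obtain ⟨a, b, d⟩ := x
    cases d
    · by_cases h : (a, b - 1) ∈ N.K D <;> simp [h]
    · by_cases h : (a - 1, b) ∈ N.K D <;> simp [h]
  right_inv y := by
    obtain ⟨a, b, d⟩ := y
    by_cases h : (a, b) ∈ N.K D <;> cases d <;> simp [h]

lemma step_left (D : Set (ℤ × ℤ)) (a b : ℤ) : N.step D ⟨a, b, true⟩ =
    ⟨a - 1, b, if (a - 1, b) ∈ N.K D then false else true⟩ := rfl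
lemma step_down (D : Set (ℤ × ℤ)) (a b : ℤ) : N.step D ⟨a, b, false⟩ =
    ⟨a, b - 1, if (a, b - 1) ∈ N.K D then true else false⟩ := rfl

lemma time_step (D : Set (ℤ × ℤ)) (x : PSt) : (N.step D x).time = x.time - 1 := by
  obtain ⟨a, b, d⟩ := x
  cases d
  · rw [step_down]; simp only [PSt.time]; ring
  · rw [step_left]; simp only [PSt.time]; ring

lemma step_g {D : Set (ℤ × ℤ)} (h : N.Valid D) (x : PSt) :
    N.step D (N.g x) = N.g (N.step D x) := by
  obtain ⟨a, b, d⟩ := x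
  have e : N.g ⟨a, b, d⟩ = ⟨b - N.n, a, !d⟩ := rfl
  rw [e]
  cases d
  · have h1 := N.K_inv h (a, b - 1)
    rw [step_down, Bool.not_false, step_left]
    simp only [gp_apply] at h1
    have e2 : b - (N.n : ℤ) - 1 = b - 1 - N.n := by ring
    rw [e2]
    ext
    · simp
    · simp
    · simp only [g_d, h1]; split_ifs <;> rfl
  · have h1 := N.K_inv h (a - 1, b)
    rw [step_left, Bool.not_true, step_down]
    simp only [gp_apply] at h1
    ext
    · simp
    · simp
    · simp only [g_d, h1]; split_ifs <;> rfl

lemma inX_step {D : Set (ℤ × ℤ)} (h : N.Valid D) {x : PSt} (hx : N.InX x) :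
    N.InX (N.step D x) := by
  obtain ⟨a, b, d⟩ := x
  cases d
  · rw [inX_down] at hx
    rw [step_down]
    have e3 := N.eq_nx_iff (a := a) (b := b - 1)
    have e4 := N.eq_pv_iff (a := a) (b := b - 1)
    by_cases hk : (a, b - 1) ∈ N.K D
    · rw [if_pos hk, inX_left]
      rcases hk with hk | hk | hk
      · have := h.sub hk
        simp only [L, Set.mem_ofPred_eq] at this; omega
      · simp only at hk
        have := N.acw (b - 1)
        rw [e3] at hk; omega
      · simp only at hk; omega
    · rw [if_neg hk, inX_down]
      simp only [K, Set.mem_ofPred_eq, not_or] at hk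
      omega
  · rw [inX_left] at hx
    rw [step_left]
    have e3 := N.eq_nx_iff (a := a - 1) (b := b)
    have e4 := N.eq_pv_iff (a := a - 1) (b := b)
    by_cases hk : (a - 1, b) ∈ N.K D
    · rw [if_pos hk, inX_down]
      rcases hk with hk | hk | hk
      · have := h.sub hk
        simp only [L, Set.mem_ofPred_eq] at this; omega
      · simp only at hk
        rw [e3] at hk; omega
      · simp only at hk
        have := N.acw (a - 1)
        omega
    · rw [if_neg hk, inX_left]
      simp only [K, Set.mem_ofPred_eq, not_or] at hk
      omega

lemma inX_step_symm {D : Set (ℤ × ℤ)} (h : N.Valid D) {x : PSt} (hx : N.InX x) :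
    N.InX ((N.step D)⁻¹ x) := by
  obtain ⟨a, b, d⟩ := x
  have e : (N.step D)⁻¹ ⟨a, b, d⟩ = if (if (a, b) ∈ N.K D then !d else d) then ⟨a + 1, b, true⟩
    else ⟨a, b + 1, false⟩ := rfl
  rw [e]
  have e3 := N.eq_nx_iff (a := a) (b := b)
  have e4 := N.eq_pv_iff (a := a) (b := b)
  have e5 := N.acw a
  have e6 := N.acw b
  by_cases hk : (a, b) ∈ N.K D
  · rw [if_pos hk]
    cases d
    · rw [inX_down] at hx
      simp only [Bool.not_false, if_true, inX_left]
      rcases hk with hk | hk | hk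
      · have := h.sub hk
        simp only [L, Set.mem_ofPred_eq] at this; omega
      · simp only at hk; omega
      · simp only at hk
        have := N.acw b; rw [e4] at hk; omega
    · rw [inX_left] at hx
      simp only [Bool.not_true, Bool.false_eq_true, if_false, inX_down]
      rcases hk with hk | hk | hk
      · have := h.sub hk
        simp only [L, Set.mem_ofPred_eq] at this; omega
      · simp only at hk; omega
      · simp only at hk; rw [e4] at hk; omega
  · rw [if_neg hk]
    simp only [K, Set.mem_ofPred_eq, not_or] at hk
    cases d
    · rw [inX_down] at hx
      simp only [Bool.false_eq_true, if_false, inX_down]; omega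
    · rw [inX_left] at hx
      simp only [if_true, inX_left]; omega

lemma inX_zpow {D : Set (ℤ × ℤ)} (h : N.Valid D) {x : PSt} (hx : N.InX x) (m : ℤ) :
    N.InX ((N.step D ^ m) x) := by
  induction m using Int.induction_on generalizing x with
  | zero => simpa
  | succ m ih => rw [zpow_add_one, Equiv.Perm.mul_apply]; exact ih (N.inX_step h hx)
  | pred m ih => rw [zpow_sub_one, Equiv.Perm.mul_apply]; exact ih (N.inX_step_symm h hx)

lemma time_zpow (D : Set (ℤ × ℤ)) (x : PSt) (m : ℤ) :
    ((N.step D ^ m) x).time = x.time - m := by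
  induction m using Int.induction_on generalizing x with
  | zero => simp
  | succ m ih => rw [zpow_add_one, Equiv.Perm.mul_apply, ih, time_step]; ring
  | pred m ih =>
    rw [zpow_sub_one, Equiv.Perm.mul_apply, ih]
    have := N.time_step D ((N.step D)⁻¹ x)
    rw [perm_apply_inv] at this
    rw [this]; ring

lemma zpow_g {D : Set (ℤ × ℤ)} (h : N.Valid D) (m : ℤ) (x : PSt) :
    (N.step D ^ m) (N.g x) = N.g ((N.step D ^ m) x) := by
  have hc : Commute (N.step D) N.g := by
    ext1 x; exact N.step_g h x
  have := (hc.zpow_left m).eq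
  exact congrArg (fun f : Equiv.Perm PSt => f x) this

lemma inX_pow {D : Set (ℤ × ℤ)} (h : N.Valid D) {x : PSt} (hx : N.InX x) (m : ℕ) :
    N.InX ((N.step D ^ m) x) := by
  have := N.inX_zpow h hx m; rwa [zpow_natCast] at this

lemma time_pow (D : Set (ℤ × ℤ)) (x : PSt) (m : ℕ) :
    ((N.step D ^ m) x).time = x.time - m := by
  have := N.time_zpow D x m; rwa [zpow_natCast] at this

lemma pow_succ_step (D : Set (ℤ × ℤ)) (x : PSt) (m : ℕ) :
    (N.step D ^ (m + 1)) x = N.step D ((N.step D ^ m) x) := by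
  rw [pow_succ', Equiv.Perm.mul_apply]

structure Good (D : Set (ℤ × ℤ)) : Prop extends N.Valid D where
  close : ∀ x, N.InX x → (N.step D ^ N.n) x = N.g x

lemma good_of_time {D : Set (ℤ × ℤ)} (h : N.Valid D) (t : ℤ)
    (ht : ∀ x, N.InX x → x.time = t → (N.step D ^ N.n) x = N.g x) : N.Good D := by
  refine ⟨h, fun x hx => ?_⟩
  have h1 := ht ((N.step D ^ (x.time - t)) x) (N.inX_zpow h hx _) (by rw [time_zpow]; ring)
  rw [← zpow_natCast, ← Equiv.Perm.mul_apply, ← zpow_add, add_comm, zpow_add,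
    Equiv.Perm.mul_apply, ← N.zpow_g h, zpow_natCast] at h1
  exact (N.step D ^ (x.time - t)).injective h1

/-- crossing of two strands in one step -/
lemma cross_step {D : Set (ℤ × ℤ)} {x y : PSt} (ht : x.time = y.time) (hk : x.key < y.key)
    (hk' : (N.step D y).key ≤ (N.step D x).key) :
    ∃ p : ℤ × ℤ, p ∉ N.K D ∧ N.step D x = ⟨p.1, p.2, true⟩ ∧ N.step D y = ⟨p.1, p.2, false⟩ := by
  have hne : N.step D x ≠ N.step D y := by
    intro h; have := (N.step D).injective h; rw [this] at hk; exact lt_irrefl _ hk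
  have hk'' : (N.step D y).key < (N.step D x).key := by
    refine lt_of_le_of_ne hk' fun h => hne ?_
    exact PSt.eq_of_key (by rw [time_step, time_step, ht]) h.symm
  obtain ⟨a, b, d⟩ := x
  obtain ⟨a', b', d'⟩ := y
  simp only [PSt.time] at ht
  cases d <;> cases d'
  · rw [step_down, step_down] at hk''
    simp only [PSt.key] at hk hk''
    exfalso
    split_ifs at hk hk'' <;> simp at hk hk'' <;> omega
  · rw [step_down, step_left] at hk''
    simp only [PSt.key] at hk hk''
    exfalso
    split_ifs at hk hk'' <;> simp at hk hk'' <;> omega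
  · have key : a - 1 = a' ∧ b = b' - 1 := by
      rw [step_down, step_left] at hk''
      simp only [PSt.key] at hk hk''
      split_ifs at hk hk'' <;> simp at hk hk'' <;> omega
    obtain ⟨e1, e2⟩ := key
    subst e1 e2
    refine ⟨(a - 1, b' - 1), ?_, ?_, ?_⟩
    · intro hmem
      rw [step_left, step_down, if_pos hmem, if_pos hmem] at hk''
      simp [PSt.key] at hk''
      omega
    · have : (a - 1, b' - 1) ∉ N.K D := by
        intro hmem
        rw [step_left, step_down, if_pos hmem, if_pos hmem] at hk''
        simp [PSt.key] at hk''
        omega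
      rw [step_left, if_neg this]
    · have : (a - 1, b' - 1) ∉ N.K D := by
        intro hmem
        rw [step_left, step_down, if_pos hmem, if_pos hmem] at hk''
        simp [PSt.key] at hk''
        omega
      rw [step_down, if_neg this]
  · rw [step_left, step_left] at hk''
    simp only [PSt.key] at hk hk''
    exfalso
    split_ifs at hk hk'' <;> simp at hk hk'' <;> omega

lemma exists_cross {D : Set (ℤ × ℤ)} {x y : PSt} (ht : x.time = y.time) (hk : x.key < y.key)
    (k : ℕ) (hk' : ((N.step D ^ k) y).key ≤ ((N.step D ^ k) x).key) :
    ∃ j : ℕ, 1 ≤ j ∧ j ≤ k ∧ ∃ p : ℤ × ℤ, p ∉ N.K D ∧ (N.step D ^ j) x = ⟨p.1, p.2, true⟩ ∧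
      (N.step D ^ j) y = ⟨p.1, p.2, false⟩ := by
  induction k with
  | zero => simp at hk'; omega
  | succ k ih =>
    by_cases h : ((N.step D ^ k) y).key ≤ ((N.step D ^ k) x).key
    · obtain ⟨j, h1, h2, h3⟩ := ih h
      exact ⟨j, h1, by omega, h3⟩
    · rw [pow_succ_step, pow_succ_step] at hk'
      obtain ⟨p, hp⟩ := N.cross_step (by rw [time_pow, time_pow, ht]) (not_le.mp h) hk'
      exact ⟨k + 1, by omega, le_rfl, p, by rw [pow_succ_step, pow_succ_step]; exact hp⟩

end PNet

namespace PNet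
variable (N : PNet)

/-- orbit of a point under the glide reflection -/
def Orb (p : ℤ × ℤ) : Set (ℤ × ℤ) := {r | ∃ m : ℤ, r = (N.gp ^ m) p}

lemma orb_inv (p r : ℤ × ℤ) : N.gp r ∈ N.Orb p ↔ r ∈ N.Orb p := by
  constructor
  · rintro ⟨m, hm⟩
    refine ⟨m - 1, ?_⟩
    apply N.gp.injective
    rw [hm, ← Equiv.Perm.mul_apply, ← zpow_one_add]
    congr 2; ring
  · rintro ⟨m, hm⟩
    refine ⟨1 + m, ?_⟩
    rw [hm, zpow_one_add, Equiv.Perm.mul_apply]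

lemma self_mem_orb (p : ℤ × ℤ) : p ∈ N.Orb p := ⟨0, by simp⟩

lemma eq_of_mem_orb {p r : ℤ × ℤ} (h : r ∈ N.Orb p) (h1 : r.1 + r.2 < p.1 + p.2 + N.n)
    (h2 : p.1 + p.2 < r.1 + r.2 + N.n) : r = p := by
  obtain ⟨m, hm⟩ := h
  have h3 := N.sum_gp_zpow m p
  rw [← hm] at h3
  have hn := N.npos
  have hm1 : m < 1 := by
    by_contra hc
    have : 1 * (N.n : ℤ) ≤ m * N.n := mul_le_mul_of_nonneg_right (not_lt.mp hc) hn.le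
    omega
  have hm2 : -1 < m := by
    by_contra hc
    have : m * (N.n : ℤ) ≤ (-1) * N.n := mul_le_mul_of_nonneg_right (not_lt.mp hc) hn.le
    omega
  have : m = 0 := by omega
  subst this
  simpa using hm

lemma mem_of_orb {D : Set (ℤ × ℤ)} (h : ∀ p, N.gp p ∈ D ↔ p ∈ D) {p r : ℤ × ℤ}
    (hr : r ∈ N.Orb p) : r ∈ D ↔ p ∈ D := by
  obtain ⟨m, rfl⟩ := hr
  exact N.inv_zpow h m p

/-- toggling two orbits -/
def tog (D : Set (ℤ × ℤ)) (p₁ p₂ : ℤ × ℤ) : Set (ℤ × ℤ) :=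
  {r | Xor (r ∈ D) (r ∈ N.Orb p₁ ∨ r ∈ N.Orb p₂)}

lemma tog_valid {D : Set (ℤ × ℤ)} (h : N.Valid D) {p₁ p₂ : ℤ × ℤ} (h1 : p₁ ∈ N.L)
    (h2 : p₂ ∈ N.L) : N.Valid (N.tog D p₁ p₂) := by
  constructor
  · rintro r (⟨hr, _⟩ | ⟨hr | hr, _⟩)
    · exact h.sub hr
    · exact (N.mem_of_orb N.L_inv hr).2 h1
    · exact (N.mem_of_orb N.L_inv hr).2 h2
  · intro r
    simp only [tog, Set.mem_ofPred_eq, h.inv, N.orb_inv]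

lemma not_corner {p : ℤ × ℤ} (h : p ∈ N.L) : ¬ (p.2 = N.nx p.1 ∨ p.2 = N.pv p.1 + N.n) := by
  simp only [L, Set.mem_ofPred_eq] at h
  omega

lemma mem_K_of_L {D : Set (ℤ × ℤ)} {p : ℤ × ℤ} (h : p ∈ N.L) : p ∈ N.K D ↔ p ∈ D := by
  have := N.not_corner h
  simp only [K, Set.mem_ofPred_eq]; tauto

/-- arrival -/
lemma step_eq_of_K {D D' : Set (ℤ × ℤ)} {w : PSt}
    (h : (N.step D w).pos ∈ N.K D' ↔ (N.step D w).pos ∈ N.K D) : N.step D' w = N.step D w := by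
  obtain ⟨a, b, d⟩ := w
  cases d
  · rw [step_down, step_down] at *
    simp only [PSt.pos] at h
    simp only [h]
  · rw [step_left, step_left] at *
    simp only [PSt.pos] at h
    simp only [h]

lemma step_eq_of_not_K {D D' : Set (ℤ × ℤ)} {w : PSt}
    (h : (N.step D w).pos ∈ N.K D' ↔ (N.step D w).pos ∉ N.K D) :
    N.step D' w = ⟨(N.step D w).a, (N.step D w).b, !(N.step D w).d⟩ := by
  obtain ⟨a, b, d⟩ := w
  cases d
  · rw [step_down, step_down] at *
    simp only [PSt.pos] at h
    by_cases h' : (a, b - 1) ∈ N.K D <;> simp [h, h']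
  · rw [step_left, step_left] at *
    simp only [PSt.pos] at h
    by_cases h' : (a - 1, b) ∈ N.K D <;> simp [h, h']

structure Meets (D : Set (ℤ × ℤ)) (x y : PSt) (k : ℕ) (p : ℤ × ℤ) : Prop where
  memL : p ∈ N.L
  hx : ((N.step D ^ k) x).pos = p
  hy : ((N.step D ^ k) y).pos = p

lemma pos_sum (x : PSt) : x.pos.1 + x.pos.2 = x.time := rfl

lemma Meets.sum {D : Set (ℤ × ℤ)} {x y : PSt} {k : ℕ} {p : ℤ × ℤ} (h : N.Meets D x y k p) :
    p.1 + p.2 = x.time - k := by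
  rw [← h.hx, pos_sum, time_pow]

lemma tog_mem_self {D : Set (ℤ × ℤ)} {p₁ p₂ r : ℤ × ℤ} (hr : r ∈ N.Orb p₁ ∨ r ∈ N.Orb p₂) :
    r ∈ N.tog D p₁ p₂ ↔ r ∉ D := by
  simp only [tog, Set.mem_ofPred_eq, Xor, hr]; tauto

lemma tog_mem_other {D : Set (ℤ × ℤ)} {p₁ p₂ r : ℤ × ℤ}
    (hr : ¬ (r ∈ N.Orb p₁ ∨ r ∈ N.Orb p₂)) : r ∈ N.tog D p₁ p₂ ↔ r ∈ D := by
  simp only [tog, Set.mem_ofPred_eq, Xor, hr]; tauto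

section surgery
variable {D : Set (ℤ × ℤ)} (hv : N.Valid D) {x y : PSt} (hxy : x ≠ y) (ht : x.time = y.time)
  {k₁ k₂ : ℕ} {p₁ p₂ : ℤ × ℤ} (m₁ : N.Meets D x y k₁ p₁) (m₂ : N.Meets D x y k₂ p₂)
  (h1 : 1 ≤ k₁) (h12 : k₁ < k₂) (h2 : k₂ ≤ N.n)

include m₁ m₂ h1 h12 h2 in
lemma orb_time {r : ℤ × ℤ} {k : ℕ} (hk : 1 ≤ k) (hkn : k ≤ N.n) (hr : r.1 + r.2 = x.time - k)
    (ho : r ∈ N.Orb p₁ ∨ r ∈ N.Orb p₂) : (k = k₁ ∧ r = p₁) ∨ (k = k₂ ∧ r = p₂) := by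
  have s1 := m₁.sum
  have s2 := m₂.sum
  rcases ho with ho | ho
  · have := N.eq_of_mem_orb ho (by omega) (by omega)
    subst this
    left; exact ⟨by omega, rfl⟩
  · have := N.eq_of_mem_orb ho (by omega) (by omega)
    subst this
    right; exact ⟨by omega, rfl⟩

include m₁ m₂ h1 h12 h2 in
lemma surg_other {z : PSt} (hz : z.time = x.time) {k : ℕ} (hkn : k + 1 ≤ N.n)
    (hk1 : k + 1 ≠ k₁) (hk2 : k + 1 ≠ k₂) :
    N.step (N.tog D p₁ p₂) ((N.step D ^ k) z) = (N.step D ^ (k + 1)) z := by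
  rw [pow_succ_step]
  apply N.step_eq_of_K
  rw [← pow_succ_step]
  have : ¬ (((N.step D ^ (k + 1)) z).pos ∈ N.Orb p₁ ∨ ((N.step D ^ (k + 1)) z).pos ∈ N.Orb p₂) := by
    intro ho
    have := N.orb_time m₁ m₂ h1 h12 h2 (k := k + 1) (by omega) hkn
      (by rw [pos_sum, time_pow, hz]) ho
    omega
  simp only [K, Set.mem_ofPred_eq, N.tog_mem_other this]

include m₁ m₂ h1 h12 h2 hxy in
lemma surg_meet {z : PSt} (hz : z.time = x.time) {k : ℕ} (hk : k + 1 = k₁ ∨ k + 1 = k₂) :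
    N.step (N.tog D p₁ p₂) ((N.step D ^ k) z) = (N.step D ^ (k + 1)) (Equiv.swap x y z) := by
  obtain ⟨p, mp, hp⟩ : ∃ p, N.Meets D x y (k + 1) p ∧ (p = p₁ ∨ p = p₂) := by
    rcases hk with hk | hk
    · exact ⟨p₁, hk ▸ m₁, Or.inl rfl⟩
    · exact ⟨p₂, hk ▸ m₂, Or.inr rfl⟩
  have hne : (N.step D ^ (k + 1)) x ≠ (N.step D ^ (k + 1)) y := fun h => hxy (Equiv.injective _ h)
  have hd := PSt.dir_ne hne (by rw [mp.hx, mp.hy])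
  have hpo : p ∈ N.Orb p₁ ∨ p ∈ N.Orb p₂ := by
    rcases hp with rfl | rfl
    · left; exact N.self_mem_orb _
    · right; exact N.self_mem_orb _
  have hpK : p ∈ N.K (N.tog D p₁ p₂) ↔ p ∉ N.K D := by
    rw [N.mem_K_of_L mp.memL, N.mem_K_of_L mp.memL, N.tog_mem_self hpo]
  have hx := mp.hx
  have hy := mp.hy
  by_cases hzx : z = x
  · subst hzx
    rw [Equiv.swap_apply_left, N.step_eq_of_not_K (D := D), ← pow_succ_step]
    · rw [← hd]
      rw [← hy] at hx
      simp only [PSt.pos, Prod.mk.injEq] at hx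
      ext <;> simp [hx]
    · rw [← pow_succ_step, hx]; exact hpK
  · by_cases hzy : z = y
    · subst hzy
      rw [Equiv.swap_apply_right, N.step_eq_of_not_K (D := D), ← pow_succ_step]
      · rw [hd]
        rw [← hy] at hx
        simp only [PSt.pos, Prod.mk.injEq] at hx
        ext <;> simp [hx]
      · rw [← pow_succ_step, hy]; exact hpK
    · rw [Equiv.swap_apply_of_ne_of_ne hzx hzy, pow_succ_step]
      apply N.step_eq_of_K
      rw [← pow_succ_step]
      have : ¬ (((N.step D ^ (k + 1)) z).pos ∈ N.Orb p₁ ∨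
          ((N.step D ^ (k + 1)) z).pos ∈ N.Orb p₂) := by
        intro ho
        have h3 := N.orb_time m₁ m₂ h1 h12 h2 (k := k + 1) (by omega) (by omega)
          (by rw [pos_sum, time_pow, hz]) ho
        have h4 : ((N.step D ^ (k + 1)) z).pos = p := by
          have s1 := m₁.sum
          have s2 := m₂.sum
          have s3 := mp.sum
          rcases h3 with ⟨h3, h4⟩ | ⟨h3, h4⟩
          · rcases hp with rfl | rfl
            · exact h4
            · omega
          · rcases hp with rfl | rfl
            · omega
            · exact h4
        have e1 := PSt.dir_ne (fun h => hzx (Equiv.injective (N.step D ^ (k + 1)) h))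
          (h4.trans hx.symm)
        have e2 := PSt.dir_ne (fun h => hzy (Equiv.injective (N.step D ^ (k + 1)) h))
          (h4.trans hy.symm)
        rw [← e1] at e2
        rw [e2] at hd
        simp at hd
      simp only [K, Set.mem_ofPred_eq, N.tog_mem_other this]

include m₁ m₂ h1 h12 h2 hxy ht in
lemma surg_path {z : PSt} (hz : z.time = x.time) (k : ℕ) (hk : k ≤ N.n) :
    (N.step (N.tog D p₁ p₂) ^ k) z =
      if k₁ ≤ k ∧ k < k₂ then (N.step D ^ k) (Equiv.swap x y z) else (N.step D ^ k) z := by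
  have hsw : ∀ z : PSt, z.time = x.time → (Equiv.swap x y z).time = x.time := by
    intro z hz
    by_cases h : z = x
    · rw [h, Equiv.swap_apply_left, ht]
    · by_cases h' : z = y
      · rw [h', Equiv.swap_apply_right]
      · rw [Equiv.swap_apply_of_ne_of_ne h h', hz]
  induction k with
  | zero => rw [if_neg (by omega)]; simp
  | succ k ih =>
    rw [pow_succ_step, ih (by omega)]
    by_cases e1 : k + 1 = k₁
    · rw [if_neg (by omega), if_pos (by omega), N.surg_meet hxy m₁ m₂ h1 h12 h2 hz (Or.inl e1)]
    · by_cases e2 : k + 1 = k₂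
      · rw [if_pos (by omega), if_neg (by omega),
          N.surg_meet hxy m₁ m₂ h1 h12 h2 (hsw z hz) (Or.inr e2), Equiv.swap_apply_self]
      · by_cases e3 : k₁ ≤ k ∧ k < k₂
        · rw [if_pos e3, if_pos (by omega), N.surg_other m₁ m₂ h1 h12 h2 (hsw z hz) hk e1 e2]
        · rw [if_neg e3, if_neg (by omega), N.surg_other m₁ m₂ h1 h12 h2 hz hk e1 e2]

end surgery

lemma surg_good {D : Set (ℤ × ℤ)} (hg : N.Good D) {x y : PSt} (hxy : x ≠ y)
    (ht : x.time = y.time)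
    {k₁ k₂ : ℕ} {p₁ p₂ : ℤ × ℤ} (m₁ : N.Meets D x y k₁ p₁) (m₂ : N.Meets D x y k₂ p₂)
    (h1 : 1 ≤ k₁) (h12 : k₁ < k₂) (h2 : k₂ ≤ N.n) : N.Good (N.tog D p₁ p₂) := by
  refine N.good_of_time (N.tog_valid hg.toValid m₁.memL m₂.memL) x.time fun z hz hzt => ?_
  rw [N.surg_path hxy ht m₁ m₂ h1 h12 h2 hzt N.n le_rfl, if_neg (by omega), hg.close z hz]

def MaxGood (D : Set (ℤ × ℤ)) : Prop := N.Good D ∧ ∀ D', D ⊂ D' → ¬ N.Good D'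

lemma meets_of_not_K {D : Set (ℤ × ℤ)} (hg : N.Valid D) {x y : PSt} (hx : N.InX x) (hy : N.InX y)
    (hxy : x ≠ y) {k : ℕ} {p : ℤ × ℤ} (hp : p ∉ N.K D) (ex : ((N.step D ^ k) x).pos = p)
    (ey : ((N.step D ^ k) y).pos = p) : N.Meets D x y k p := by
  refine ⟨?_, ex, ey⟩
  have hd := PSt.dir_ne (fun h => hxy (Equiv.injective (N.step D ^ k) h)) (ex.trans ey.symm)
  have hx' := N.inX_pow hg hx k
  have hy' := N.inX_pow hg hy k
  generalize (N.step D ^ k) x = X at *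
  generalize (N.step D ^ k) y = Y at *
  obtain ⟨a, b, d⟩ := X
  obtain ⟨a', b', d'⟩ := Y
  simp only [PSt.pos] at ex ey
  subst ex
  rw [Prod.mk.injEq] at ey
  obtain ⟨rfl, rfl⟩ := ey
  simp only at hd
  subst hd
  have e3 := N.eq_nx_iff (a := a') (b := b')
  have e4 := N.eq_pv_iff (a := a') (b := b')
  simp only [K, Set.mem_ofPred_eq, not_or] at hp
  simp only [L, Set.mem_ofPred_eq]
  cases d
  · rw [Bool.not_false, inX_left] at hy'
    rw [inX_down] at hx'
    omega
  · rw [Bool.not_true, inX_down] at hy'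
    rw [inX_left] at hx'
    omega

lemma reduced {D : Set (ℤ × ℤ)} (hg : N.MaxGood D) {x y : PSt} (hxy : x ≠ y)
    (ht : x.time = y.time)
    {k₁ k₂ : ℕ} {p₁ p₂ : ℤ × ℤ} (m₁ : N.Meets D x y k₁ p₁) (m₂ : N.Meets D x y k₂ p₂)
    (h1 : 1 ≤ k₁) (h12 : k₁ < k₂) (h2 : k₂ ≤ N.n) (n₁ : p₁ ∉ D) (n₂ : p₂ ∉ D) : False := by
  refine hg.2 _ ?_ (N.surg_good hg.1 hxy ht m₁ m₂ h1 h12 h2)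
  have hor : ∀ r, r ∈ N.Orb p₁ ∨ r ∈ N.Orb p₂ → r ∉ D := by
    rintro r (hr | hr)
    · rwa [N.mem_of_orb hg.1.inv hr]
    · rwa [N.mem_of_orb hg.1.inv hr]
  constructor
  · intro r hr
    left
    exact ⟨hr, fun h => hor r h hr⟩
  · intro hsub
    apply n₁
    apply hsub
    rw [N.tog_mem_self (Or.inl (N.self_mem_orb _))]
    exact n₁

/-! counting -/

def Xt (t : ℤ) : Set PSt := {x | N.InX x ∧ x.time = t}
def Qt (t : ℤ) : Set (PSt × PSt) := {q | q.1 ∈ N.Xt t ∧ q.2 ∈ N.Xt t ∧ q.1.key < q.2.key}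
def Wt (D : Set (ℤ × ℤ)) (t : ℤ) : Set (ℤ × ℤ) :=
  {p | p ∈ N.L ∧ p ∉ D ∧ t - N.n ≤ p.1 + p.2 ∧ p.1 + p.2 < t}

lemma Xt_finite (t : ℤ) : (N.Xt t).Finite := by
  have : N.Xt t ⊆ (fun q : ℤ × Bool => (⟨q.1, t - q.1, q.2⟩ : PSt)) ''
      ((Set.Icc (t - 2 * N.n - |t|) (t + |t| + N.n)) ×ˢ Set.univ) := by
    rintro ⟨a, b, d⟩ ⟨hx, ht⟩
    refine ⟨(a, d), ⟨?_, trivial⟩, ?_⟩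
    · simp only [PSt.time] at ht
      have h1 : a ≤ b ∧ b ≤ a + N.n := by
        cases d
        · rw [inX_down] at hx
          have := N.lt_nx a
          have := N.pv_lt a
          omega
        · rw [inX_left] at hx
          have := N.lt_nx b
          have := N.pv_lt b
          omega
      have := le_abs_self t
      have := neg_abs_le t
      simp only [Set.mem_Icc]
      omega
    · simp only [PSt.time] at ht
      simp only [PSt.mk.injEq, true_and, and_true]; omega
  exact (((Set.finite_Icc _ _).prod Set.finite_univ).image _).subset this

lemma Qt_finite (t : ℤ) : (N.Qt t).Finite :=
  ((N.Xt_finite t).prod (N.Xt_finite t)).subset fun _ hq => ⟨hq.1, hq.2.1⟩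

lemma Wt_finite (D : Set (ℤ × ℤ)) (t : ℤ) : (N.Wt D t).Finite := by
  have : N.Wt D t ⊆ Set.Icc (-|t| - 2 * N.n) (|t| + 2 * N.n) ×ˢ
      Set.Icc (-|t| - 2 * N.n) (|t| + 2 * N.n) := by
    rintro ⟨a, b⟩ ⟨hL, _, h1, h2⟩
    simp only [L, Set.mem_ofPred_eq] at hL
    have := N.lt_nx a
    have := N.pv_lt a
    have := le_abs_self t
    have := neg_abs_le t
    simp only at h1 h2
    simp only [Set.mem_prod, Set.mem_Icc]
    omega
  exact ((Set.finite_Icc _ _).prod (Set.finite_Icc _ _)).subset this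

lemma card_le_W {D : Set (ℤ × ℤ)} (hg : N.Good D) (t : ℤ) :
    (N.Qt t).ncard ≤ (N.Wt D t).ncard := by
  have hex : ∀ q ∈ N.Qt t, ∃ j : ℕ, 1 ≤ j ∧ j ≤ N.n ∧ ∃ p : ℤ × ℤ, p ∉ N.K D ∧
      (N.step D ^ j) q.1 = ⟨p.1, p.2, true⟩ ∧ (N.step D ^ j) q.2 = ⟨p.1, p.2, false⟩ := by
    rintro ⟨x, y⟩ ⟨⟨hx, hxt⟩, ⟨hy, hyt⟩, hk⟩
    simp only at *
    apply N.exists_cross (hxt.trans hyt.symm) hk N.n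
    rw [hg.close x hx, hg.close y hy, key_g, key_g]
    omega
  choose! j hj1 hj2 p hpK hpx hpy using hex
  refine Set.ncard_le_ncard_of_injOn p ?_ ?_ (N.Wt_finite D t)
  · rintro ⟨x, y⟩ hq
    have hq' := hq
    obtain ⟨⟨hx, hxt⟩, ⟨hy, hyt⟩, hk⟩ := hq'
    have e1 := hpx _ hq
    have e2 := hpy _ hq
    have e3 := hpK _ hq
    have e4 := hj1 _ hq
    have e5 := hj2 _ hq
    simp only at hx hxt hy hyt hk e1 e2
    have m := N.meets_of_not_K hg.toValid hx hy (by rintro rfl; exact lt_irrefl _ hk)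
      (k := j (x, y)) e3 (by rw [e1]; rfl) (by rw [e2]; rfl)
    have s := m.sum
    refine ⟨m.memL, fun h => e3 (Or.inl h), ?_, ?_⟩ <;> omega
  · rintro ⟨x, y⟩ hq ⟨x', y'⟩ hq' heq
    have e1 := hpx _ hq
    have e2 := hpy _ hq
    have f1 := hpx _ hq'
    have f2 := hpy _ hq'
    simp only at e1 e2 f1 f2
    rw [← heq] at f1 f2
    have hj : j (x, y) = j (x', y') := by
      have t1 := congrArg PSt.time e1
      have t2 := congrArg PSt.time f1
      rw [time_pow] at t1 t2
      have := hq.1.2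
      have := hq'.1.2
      simp only [PSt.time] at *
      omega
    rw [← hj] at f1 f2
    have g1 := Equiv.injective _ (e1.trans f1.symm)
    have g2 := Equiv.injective _ (e2.trans f2.symm)
    rw [g1, g2]

lemma W_le_card {D : Set (ℤ × ℤ)} (hg : N.MaxGood D) (t : ℤ) :
    (N.Wt D t).ncard ≤ (N.Qt t).ncard := by
  let X : ℤ × ℤ → PSt := fun p => (N.step D ^ (p.1 + p.2 - t)) ⟨p.1, p.2, true⟩
  let Y : ℤ × ℤ → PSt := fun p => (N.step D ^ (p.1 + p.2 - t)) ⟨p.1, p.2, false⟩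
  let f : ℤ × ℤ → PSt × PSt := fun p => if (X p).key < (Y p).key then (X p, Y p) else (Y p, X p)
  have hXX : ∀ p ∈ N.L, X p ∈ N.Xt t := by
    intro p hp
    refine ⟨N.inX_zpow hg.1.toValid ?_ _, ?_⟩
    · simp only [L, Set.mem_ofPred_eq] at hp
      rw [inX_left]; omega
    · simp only [X, time_zpow]; simp only [PSt.time]; ring
  have hYY : ∀ p ∈ N.L, Y p ∈ N.Xt t := by
    intro p hp
    refine ⟨N.inX_zpow hg.1.toValid ?_ _, ?_⟩
    · simp only [L, Set.mem_ofPred_eq] at hp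
      rw [inX_down]; omega
    · simp only [Y, time_zpow]; simp only [PSt.time]; ring
  have hne : ∀ p, X p ≠ Y p := by
    intro p h
    have := Equiv.injective _ h
    simp at this
  have hmeet : ∀ p ∈ N.Wt D t, 1 ≤ (t - (p.1 + p.2)).toNat ∧ (t - (p.1 + p.2)).toNat ≤ N.n ∧
      N.Meets D (X p) (Y p) (t - (p.1 + p.2)).toNat p := by
    rintro p ⟨hL, hD, h1, h2⟩
    refine ⟨by omega, by omega, hL, ?_, ?_⟩
    · rw [← zpow_natCast, Int.toNat_of_nonneg (by omega)]
      simp only [X]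
      rw [← Equiv.Perm.mul_apply, ← zpow_add]
      rw [show t - (p.1 + p.2) + (p.1 + p.2 - t) = 0 by ring]
      rfl
    · rw [← zpow_natCast, Int.toNat_of_nonneg (by omega)]
      simp only [Y]
      rw [← Equiv.Perm.mul_apply, ← zpow_add]
      rw [show t - (p.1 + p.2) + (p.1 + p.2 - t) = 0 by ring]
      rfl
  refine Set.ncard_le_ncard_of_injOn f ?_ ?_ (N.Qt_finite t)
  · rintro p ⟨hL, hD, h1, h2⟩
    simp only [f]
    split_ifs with hk
    · exact ⟨hXX p hL, hYY p hL, hk⟩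
    · refine ⟨hYY p hL, hXX p hL, ?_⟩
      refine lt_of_le_of_ne (not_lt.mp hk) fun h => hne p ?_
      exact (PSt.eq_of_key ((hYY p hL).2.trans (hXX p hL).2.symm) h).symm
  · intro p hp p' hp' heq
    obtain ⟨a1, a2, mp⟩ := hmeet p hp
    obtain ⟨b1, b2, mp'⟩ := hmeet p' hp'
    have ht : (X p).time = (Y p).time := (hXX p hp.1).2.trans (hYY p hp.1).2.symm
    have mp2 : N.Meets D (X p) (Y p) (t - (p'.1 + p'.2)).toNat p' := by
      simp only [f] at heq
      split_ifs at heq with c1 c2 c2 <;> rw [Prod.mk.injEq] at heq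
      · rw [heq.1, heq.2]; exact mp'
      · rw [heq.1, heq.2]; exact ⟨mp'.memL, mp'.hy, mp'.hx⟩
      · rw [heq.1, heq.2]; exact ⟨mp'.memL, mp'.hy, mp'.hx⟩
      · rw [heq.1, heq.2]; exact mp'
    rcases lt_trichotomy (t - (p.1 + p.2)).toNat (t - (p'.1 + p'.2)).toNat with h | h | h
    · exact (N.reduced hg (hne p) ht mp mp2 a1 h b2 hp.2.1 hp'.2.1).elim
    · rw [← mp.hx, ← mp2.hx, h]
    · exact (N.reduced hg (hne p) ht mp2 mp b1 h a2 hp'.2.1 hp.2.1).elim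

lemma exists_window (t : ℤ) (p : ℤ × ℤ) : ∃ r ∈ N.Orb p, t - N.n ≤ r.1 + r.2 ∧ r.1 + r.2 < t := by
  refine ⟨(N.gp ^ ((p.1 + p.2 - (t - N.n)) / N.n)) p, ⟨_, rfl⟩, ?_⟩
  rw [sum_gp_zpow]
  have hn := N.npos
  have h1 := Int.emod_add_mul_ediv (p.1 + p.2 - (t - N.n)) N.n
  have h2 := Int.emod_nonneg (p.1 + p.2 - (t - N.n)) hn.ne'
  have h3 := Int.emod_lt_of_pos (p.1 + p.2 - (t - N.n)) hn
  rw [mul_comm]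
  constructor <;> linarith

lemma maxGood_of_card {D : Set (ℤ × ℤ)} (hg : N.Good D) (t : ℤ)
    (h : (N.Wt D t).ncard ≤ (N.Qt t).ncard) : N.MaxGood D := by
  refine ⟨hg, fun D' hD' hg' => ?_⟩
  have h1 := N.card_le_W hg' t
  obtain ⟨hs, hns⟩ := hD'
  obtain ⟨p, hp', hp⟩ := Set.not_subset.mp hns
  obtain ⟨r, hr, w1, w2⟩ := N.exists_window t p
  have hss : N.Wt D' t ⊂ N.Wt D t := by
    refine ⟨fun q hq => ⟨hq.1, fun h => hq.2.1 (hs h), hq.2.2⟩, fun hsub => ?_⟩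
    have hrD' : r ∈ D' := (N.mem_of_orb hg'.inv hr).2 hp'
    have : r ∈ N.Wt D t := ⟨hg'.sub hrD', fun h => hp ((N.mem_of_orb hg.inv hr).1 h), w1, w2⟩
    exact (hsub this).2.1 hrD'
  have := Set.ncard_lt_ncard hss (N.Wt_finite D t)
  omega

lemma flip_maxGood {D : Set (ℤ × ℤ)} (hg : N.MaxGood D) {x y : PSt} (hxy : x ≠ y)
    (ht : x.time = y.time)
    {k₁ k₂ : ℕ} {p₁ p₂ : ℤ × ℤ} (m₁ : N.Meets D x y k₁ p₁) (m₂ : N.Meets D x y k₂ p₂)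
    (h1 : 1 ≤ k₁) (h12 : k₁ < k₂) (h2 : k₂ ≤ N.n) (n₁ : p₁ ∈ D) (n₂ : p₂ ∉ D) :
    N.MaxGood (N.tog D p₁ p₂) := by
  refine N.maxGood_of_card (N.surg_good hg.1 hxy ht m₁ m₂ h1 h12 h2) x.time ?_
  refine le_trans ?_ (N.W_le_card hg x.time)
  have s2 := m₂.sum
  have hp2 : p₂ ∈ N.Wt D x.time := ⟨m₂.memL, n₂, by omega, by omega⟩
  have hsub : N.Wt (N.tog D p₁ p₂) x.time ⊆ insert p₁ (N.Wt D x.time \ {p₂}) := by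
    rintro r ⟨hL, hD, w1, w2⟩
    by_cases ho : r ∈ N.Orb p₁ ∨ r ∈ N.Orb p₂
    · have h3 := N.orb_time m₁ m₂ h1 h12 h2 (r := r) (k := (x.time - (r.1 + r.2)).toNat) (by omega)
        (by omega) (by omega) ho
      rcases h3 with ⟨_, rfl⟩ | ⟨_, rfl⟩
      · exact Set.mem_insert _ _
      · rw [N.tog_mem_self ho] at hD
        exact (hD n₂).elim
    · rw [N.tog_mem_other ho] at hD
      refine Set.mem_insert_of_mem _ ⟨⟨hL, hD, w1, w2⟩, ?_⟩
      rintro rfl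
      exact ho (Or.inr (N.self_mem_orb _))
  have hfin := (N.Wt_finite D x.time)
  calc _ ≤ (insert p₁ (N.Wt D x.time \ {p₂})).ncard :=
        Set.ncard_le_ncard hsub ((hfin.sdiff).insert _)
    _ ≤ (N.Wt D x.time \ {p₂}).ncard + 1 := Set.ncard_insert_le _ _
    _ = _ := Set.ncard_sdiff_singleton_add_one hp2 hfin

/-! the flipping process -/

/-- elementary flip in index form -/
def CFlip (D D' : Set (ℤ × ℤ)) : Prop :=
  N.MaxGood D' ∧ ∃ p₁ p₂, p₁ ∈ D ∧ p₂ ∉ D ∧ p₂ ∈ N.L ∧ D' = N.tog D p₁ p₂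

/-- the strand of `x` does not touch from below at index `j` -/
def NTB (D : Set (ℤ × ℤ)) (x : PSt) (j : ℕ) : Prop :=
  ¬ (((N.step D ^ j) x).d = false ∧ ((N.step D ^ j) x).pos ∈ D)

lemma flip_loop {D : Set (ℤ × ℤ)} (hg : N.MaxGood D) {x : PSt} (hx : N.InX x)
    (hmin : ∀ y, N.InX y → y.time = x.time → x.key ≤ y.key) (k : ℕ) (hk : k ≤ N.n) :
    ∃ D', Relation.ReflTransGen N.CFlip D D' ∧ N.MaxGood D' ∧
      ∀ j, 1 ≤ j → j ≤ k → ¬ (((N.step D' ^ (j - 1)) x).d = true ∧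
        ((N.step D' ^ j) x).d = false ∧ ((N.step D' ^ j) x).pos ∈ D') := by
  induction k with
  | zero => exact ⟨D, .refl, hg, by intro j h1 h2; omega⟩
  | succ k ih =>
    obtain ⟨E, hE, hgE, hN⟩ := ih (by omega)
    by_cases hc : ((N.step E ^ k) x).d = true ∧
        ((N.step E ^ (k + 1)) x).d = false ∧ ((N.step E ^ (k + 1)) x).pos ∈ E
    swap
    · refine ⟨E, hE, hgE, fun j h1 h2 => ?_⟩
      by_cases e : j = k + 1
      · subst e; exact hc
      · exact hN j h1 (by omega)
    · obtain ⟨c1, c2, c3⟩ := hc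
      obtain ⟨p, hp⟩ : ∃ p, p = ((N.step E ^ (k + 1)) x).pos := ⟨_, rfl⟩
      rw [← hp] at c3
      have hpL := hgE.1.sub c3
      obtain ⟨y, hy⟩ : ∃ y, y = (N.step E ^ (-(k + 1 : ℕ) : ℤ)) ⟨p.1, p.2, true⟩ := ⟨_, rfl⟩
      have hyX : N.InX y := by
        rw [hy]; apply N.inX_zpow hgE.1.toValid
        simp only [L, Set.mem_ofPred_eq] at hpL
        rw [inX_left]; omega
      have hyk : (N.step E ^ (k + 1)) y = ⟨p.1, p.2, true⟩ := by
        rw [hy, ← zpow_natCast, ← Equiv.Perm.mul_apply, ← zpow_add]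
        simp
      have hxk : (N.step E ^ (k + 1)) x = ⟨p.1, p.2, false⟩ := by
        rw [hp]; ext
        · rfl
        · rfl
        · exact c2
      have hxt : x.time = y.time := by
        have t1 := N.time_pow E x (k + 1)
        have t2 := N.time_pow E y (k + 1)
        rw [hyk] at t2; rw [hxk] at t1
        simp only [PSt.time] at *; omega
      have hne : x ≠ y := by
        rintro rfl
        rw [hxk] at hyk
        simp at hyk
      have hkey : x.key < y.key := lt_of_le_of_ne (hmin y hyX hxt.symm)
        fun h => hne (PSt.eq_of_key hxt h)
      have m₁ : N.Meets E x y (k + 1) p := ⟨hpL, hp.symm, by rw [hyk]; rfl⟩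
      obtain ⟨j, hj1, hj2, r, hrK, hrx, hry⟩ := N.exists_cross (D := E)
        (x := (N.step E ^ (k + 1)) x) (y := (N.step E ^ (k + 1)) y)
        (by rw [time_pow, time_pow, hxt]) (by rw [hxk, hyk]; simp [PSt.key])
        (N.n - (k + 1)) (by
          rw [← Equiv.Perm.mul_apply, ← Equiv.Perm.mul_apply, ← pow_add, Nat.sub_add_cancel hk,
            hgE.1.close x hx, hgE.1.close y hyX, key_g, key_g]
          omega)
      rw [← Equiv.Perm.mul_apply, ← pow_add] at hrx hry
      have m₂ : N.Meets E x y (j + (k + 1)) r := N.meets_of_not_K hgE.1.toValid hx hyX hne hrK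
        (by rw [hrx]; rfl) (by rw [hry]; rfl)
      have hrE : r ∉ E := fun h => hrK (Or.inl h)
      have hgF := N.flip_maxGood hgE hne hxt m₁ m₂ (by omega) (by omega) (by omega) c3 hrE
      refine ⟨N.tog E p r, hE.tail ⟨hgF, p, r, c3, hrE, m₂.memL, rfl⟩, hgF, ?_⟩
      intro i h1 h2
      have hpath := fun i hi => N.surg_path hne hxt m₁ m₂ (by omega) (by omega) (by omega)
        (z := x) rfl i hi
      by_cases e : i = k + 1
      · subst e
        rw [hpath (k + 1) (by omega), if_pos (by omega), Equiv.swap_apply_left, hyk]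
        simp
      · rw [hpath i (by omega), hpath (i - 1) (by omega), if_neg (by omega), if_neg (by omega)]
        have : ((N.step E ^ i) x).pos ∈ N.tog E p r ↔ ((N.step E ^ i) x).pos ∈ E := by
          apply N.tog_mem_other
          intro ho
          have := N.orb_time m₁ m₂ (by omega) (by omega) (by omega) (k := i) h1 (by omega)
            (by rw [pos_sum, time_pow]) ho
          omega
        rw [this]
        exact hN i h1 (by omega)

/-- the extremal strand never crosses downwards -/
lemma no_cross_down {D : Set (ℤ × ℤ)} (hg : N.MaxGood D) {x : PSt} (hx : N.InX x)
    (hmin : ∀ y, N.InX y → y.time = x.time → x.key ≤ y.key) (k : ℕ) (hk : k + 1 ≤ N.n)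
    {p : ℤ × ℤ} (hpL : p ∈ N.L) (hpD : p ∉ D)
    (hxk : (N.step D ^ (k + 1)) x = ⟨p.1, p.2, false⟩) : False := by
  have hpK : p ∉ N.K D := by rwa [N.mem_K_of_L hpL]
  obtain ⟨y, hy⟩ : ∃ y, y = (N.step D ^ (-(k + 1 : ℕ) : ℤ)) ⟨p.1, p.2, true⟩ := ⟨_, rfl⟩
  have hyX : N.InX y := by
    rw [hy]; apply N.inX_zpow hg.1.toValid
    simp only [L, Set.mem_ofPred_eq] at hpL
    rw [inX_left]; omega
  have hyk : (N.step D ^ (k + 1)) y = ⟨p.1, p.2, true⟩ := by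
    rw [hy, ← zpow_natCast, ← Equiv.Perm.mul_apply, ← zpow_add]
    simp
  have hxt : x.time = y.time := by
    have t1 := N.time_pow D x (k + 1)
    have t2 := N.time_pow D y (k + 1)
    rw [hyk] at t2; rw [hxk] at t1
    simp only [PSt.time] at *; omega
  have hne : x ≠ y := by
    rintro rfl
    rw [hxk] at hyk
    simp at hyk
  have hkey : x.key < y.key := lt_of_le_of_ne (hmin y hyX hxt.symm)
    fun h => hne (PSt.eq_of_key hxt h)
  have m₂ : N.Meets D x y (k + 1) p := ⟨hpL, by rw [hxk]; rfl, by rw [hyk]; rfl⟩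
  have bx : (N.step D ^ k) x = ⟨p.1, p.2 + 1, false⟩ := by
    apply (N.step D).injective
    rw [← pow_succ_step, hxk, step_down]
    simp [hpK]
  have by' : (N.step D ^ k) y = ⟨p.1 + 1, p.2, true⟩ := by
    apply (N.step D).injective
    rw [← pow_succ_step, hyk, step_left]
    simp [hpK]
  obtain ⟨j, hj1, hj2, r, hrK, hrx, hry⟩ := N.exists_cross (D := D) hxt hkey k
    (by rw [bx, by']; simp [PSt.key]; omega)
  have m₁ : N.Meets D x y j r := N.meets_of_not_K hg.1.toValid hx hyX hne hrK
    (by rw [hrx]; rfl) (by rw [hry]; rfl)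
  exact N.reduced hg hne hxt m₁ m₂ hj1 (by omega) hk (fun h => hrK (Or.inl h)) hpD

end PNet

/-! ### Geometry on the unit circle -/

/-- point of the circle at angle `t` -/
def cpt (t : ℝ) : ℂ := cexp (t * I)

lemma cpt_sub (α β : ℝ) : cpt α - cpt β =
    (2 * Real.sin ((α - β) / 2) : ℝ) * (I * cexp ((((α + β) / 2 : ℝ) : ℂ) * I)) := by
  have h1 : cpt α = cexp ((((α + β) / 2 : ℝ) : ℂ) * I) * cexp ((((α - β) / 2 : ℝ) : ℂ) * I) := by
    rw [← Complex.exp_add, cpt]; congr 1; push_cast; ring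
  have h2 : cpt β = cexp ((((α + β) / 2 : ℝ) : ℂ) * I) * cexp (-(((α - β) / 2 : ℝ) : ℂ) * I) := by
    rw [← Complex.exp_add, cpt]; congr 1; push_cast; ring
  rw [h1, h2, Complex.exp_mul_I (((α - β) / 2 : ℝ) : ℂ), Complex.exp_mul_I (-_), Complex.cos_neg, Complex.sin_neg]
  push_cast
  ring

lemma vangle_cpt {α β γ : ℝ} (h1 : β < α) (h2 : α < β + 2 * Real.pi) (h3 : β < γ)
    (h4 : γ < β + 2 * Real.pi) : vangle (cpt α) (cpt β) (cpt γ) = |α - γ| / 2 := by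
  have hs1 : 0 < Real.sin ((α - β) / 2) := Real.sin_pos_of_pos_of_lt_pi (by linarith) (by linarith)
  have hs2 : 0 < Real.sin ((γ - β) / 2) := Real.sin_pos_of_pos_of_lt_pi (by linarith) (by linarith)
  have key : (cpt α - cpt β) / (cpt γ - cpt β) =
      ((Real.sin ((α - β) / 2) / Real.sin ((γ - β) / 2) : ℝ) : ℂ) *
        (Complex.cos (((α - γ) / 2 : ℝ) : ℂ) + Complex.sin (((α - γ) / 2 : ℝ) : ℂ) * I) := by
    rw [← Complex.exp_mul_I, cpt_sub, cpt_sub]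
    have e : cexp ((((α + β) / 2 : ℝ) : ℂ) * I) =
        cexp ((((α - γ) / 2 : ℝ) : ℂ) * I) * cexp ((((γ + β) / 2 : ℝ) : ℂ) * I) := by
      rw [← Complex.exp_add]; congr 1; push_cast; ring
    rw [e]
    have n1 : cexp ((((γ + β) / 2 : ℝ) : ℂ) * I) ≠ 0 := Complex.exp_ne_zero _
    have n2 : ((Real.sin ((γ - β) / 2) : ℝ) : ℂ) ≠ 0 := by
      exact_mod_cast hs2.ne'
    have n3 := Complex.I_ne_zero
    push_cast at n2 ⊢
    field_simp
  rw [vangle, key, Complex.arg_mul_cos_add_sin_mul_I (div_pos hs1 hs2)]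
  · rw [abs_div, abs_of_pos (two_pos : (0 : ℝ) < 2)]
  · constructor <;> linarith

lemma vangle_self_left (v z : ℂ) : vangle v v z = 0 := by simp [vangle]
lemma vangle_self_right (v z : ℂ) : vangle z v v = 0 := by simp [vangle]

lemma posArc_cpt {α β : ℝ} (h1 : α < β) (h2 : β ≤ α + 2 * Real.pi) :
    posArc (cpt α) (cpt β) = β - α := by
  have e : cpt β / cpt α = ((1 : ℝ) : ℂ) *
      (Complex.cos ((β - α : ℝ) : ℂ) + Complex.sin ((β - α : ℝ) : ℂ) * I) := by
    rw [← Complex.exp_mul_I, cpt, cpt, ← Complex.exp_sub]; push_cast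
    rw [one_mul]; congr 1; ring
  have e' : cpt β / cpt α = ((1 : ℝ) : ℂ) *
      (Complex.cos ((β - α - 2 * Real.pi : ℝ) : ℂ) + Complex.sin ((β - α - 2 * Real.pi : ℝ) : ℂ) * I) := by
    rw [e]; push_cast
    rw [Complex.cos_sub_two_pi, Complex.sin_sub_two_pi]
  by_cases h : β - α ≤ Real.pi
  · have : Complex.arg (cpt β / cpt α) = β - α := by
      rw [e]; exact Complex.arg_mul_cos_add_sin_mul_I one_pos ⟨by linarith [Real.pi_pos], h⟩
    rw [posArc, this, if_pos (by linarith)]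
  · push Not at h
    have : Complex.arg (cpt β / cpt α) = β - α - 2 * Real.pi := by
      rw [e']; exact Complex.arg_mul_cos_add_sin_mul_I one_pos ⟨by linarith, by linarith⟩
    rw [posArc, this]
    rw [if_neg (by linarith)]; ring

lemma cpt_eq_iff {α β : ℝ} : cpt α = cpt β ↔ ∃ m : ℤ, α = β + m * (2 * Real.pi) := by
  rw [cpt, cpt, Complex.exp_eq_exp_iff_exists_int]
  constructor
  · rintro ⟨m, hm⟩
    refine ⟨m, ?_⟩
    have := congrArg Complex.im hm
    simpa [mul_comm, mul_assoc, mul_left_comm] using this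
  · rintro ⟨m, hm⟩
    refine ⟨m, ?_⟩
    rw [hm]; push_cast; ring

/-- A cyclic enumeration of a finite set of points of the circle. -/
structure CEnum (V : Finset ℂ) where
  θ : ℤ → ℝ
  mono : StrictMono θ
  per : ∀ i, θ (i + V.card) = θ i + 2 * Real.pi
  mem : ∀ z, z ∈ V ↔ ∃ i, z = cpt (θ i)

lemma exists_cenum (V : Finset ℂ) (hne : V.Nonempty) (hV : ∀ v ∈ V, ‖v‖ = 1) :
    Nonempty (CEnum V) := by
  have harg : ∀ v ∈ V, cpt (Complex.arg v) = v := by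
    intro v hv
    have := Complex.norm_mul_exp_arg_mul_I v
    rw [hV v hv] at this
    simpa [cpt] using this
  set A := V.image Complex.arg with hA
  have hcard : A.card = V.card := by
    apply Finset.card_image_of_injOn
    intro x hx y hy hxy
    rw [← harg x hx, ← harg y hy, hxy]
  set N := V.card with hN
  have hNpos : 0 < N := Finset.card_pos.mpr hne
  set f := A.orderEmbOfFin hcard with hf
  have hfm : ∀ i, f i ∈ A := fun i => Finset.orderEmbOfFin_mem A hcard i
  have hfb : ∀ i, -Real.pi < f i ∧ f i ≤ Real.pi := by
    intro i
    obtain ⟨v, -, hv⟩ := Finset.mem_image.mp (hfm i)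
    rw [← hv]; exact ⟨Complex.neg_pi_lt_arg v, Complex.arg_le_pi v⟩
  have hNz : (0 : ℤ) < N := by exact_mod_cast hNpos
  have hmod : ∀ i : ℤ, (i % N).toNat < N := by
    intro i
    have := Int.emod_lt_of_pos i hNz
    have := Int.emod_nonneg i hNz.ne'
    omega
  let θ : ℤ → ℝ := fun i => f ⟨(i % N).toNat, hmod i⟩ + (i / N : ℤ) * (2 * Real.pi)
  refine ⟨⟨θ, ?_, ?_, ?_⟩⟩
  · apply strictMono_int_of_lt_succ
    intro i
    have h0 := Int.emod_nonneg i hNz.ne'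
    have h1 := Int.emod_lt_of_pos i hNz
    have h2 := Int.emod_add_mul_ediv i N
    by_cases hc : i % N + 1 < N
    · have e1 : (i + 1) / N = i / N := by
        rw [Int.ediv_eq_iff_of_pos hNz]; constructor <;> nlinarith
      have e2 : (i + 1) % N = i % N + 1 := by
        have := Int.emod_add_mul_ediv (i+1) N
        rw [e1] at this; linarith
      show f _ + _ < f _ + _
      rw [e1]
      have : f ⟨(i % N).toNat, hmod i⟩ < f ⟨((i + 1) % N).toNat, hmod (i+1)⟩ := by
        apply f.strictMono
        rw [Fin.mk_lt_mk, e2]; omega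
      linarith
    · have e1 : (i + 1) / N = i / N + 1 := by
        rw [Int.ediv_eq_iff_of_pos hNz]; constructor <;> nlinarith
      show f _ + _ < f _ + _
      rw [e1]
      have a1 := (hfb ⟨(i % N).toNat, hmod i⟩).2
      have a2 := (hfb ⟨((i + 1) % N).toNat, hmod (i+1)⟩).1
      push_cast
      linarith
  · intro i
    show θ (i + N) = θ i + 2 * Real.pi
    have e1 : (i + N) / N = i / N + 1 := by
      rw [Int.add_ediv_of_dvd_right (dvd_refl _), Int.ediv_self hNz.ne']
    simp only [θ, Int.add_emod_right, e1]
    push_cast; ring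
  · intro z
    constructor
    · intro hz
      have : z.arg ∈ A := Finset.mem_image_of_mem _ hz
      rw [← Finset.mem_coe, ← Finset.range_orderEmbOfFin A hcard] at this
      obtain ⟨j, hj⟩ := this
      refine ⟨j, ?_⟩
      show z = cpt (f _ + _)
      have e1 : ((j : ℕ) : ℤ) / N = 0 := Int.ediv_eq_zero_of_lt (by omega) (by omega)
      have e2 : ((j : ℕ) : ℤ) % N = j := Int.emod_eq_of_lt (by omega) (by omega)
      simp only [e1, e2, Int.toNat_natCast, Fin.eta, Int.cast_zero, zero_mul, add_zero]
      rw [hj, harg z hz]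
    · rintro ⟨i, rfl⟩
      obtain ⟨v, hv, hv'⟩ := Finset.mem_image.mp (hfm ⟨(i % N).toNat, hmod i⟩)
      have : cpt (θ i) = cpt v.arg := by
        rw [cpt_eq_iff]; exact ⟨i / N, by rw [hv']⟩
      rw [this, harg v hv]; exact hv

namespace CEnum
variable {V : Finset ℂ} (e : CEnum V)

def q (i : ℤ) : ℂ := cpt (e.θ i)

lemma q_mem (i : ℤ) : e.q i ∈ V := (e.mem _).mpr ⟨i, rfl⟩

include e in
lemma cpos : (0 : ℤ) < V.card := by
  have := Finset.card_pos.mpr ⟨_, e.q_mem 0⟩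
  exact_mod_cast this

lemma per_mul (i m : ℤ) : e.θ (i + m * V.card) = e.θ i + m * (2 * Real.pi) := by
  induction m using Int.induction_on with
  | zero => simp
  | succ m ih =>
    have := e.per (i + m * V.card)
    rw [show i + ((m : ℤ) + 1) * V.card = i + m * V.card + V.card by ring, this, ih]
    push_cast; ring
  | pred m ih =>
    have := e.per (i + (-(m : ℤ) - 1) * V.card)
    rw [show i + (-(m : ℤ) - 1) * V.card + V.card = i + -m * V.card by ring, ih] at this
    push_cast at *; linarith

lemma q_add (i : ℤ) : e.q (i + V.card) = e.q i := by
  rw [q, q, e.per, cpt_eq_iff]; exact ⟨1, by simp⟩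

lemma q_sub (i : ℤ) : e.q (i - V.card) = e.q i := by
  rw [← e.q_add (i - V.card), sub_add_cancel]

lemma exists_theta {α : ℝ} (h : cpt α ∈ V) : ∃ j, e.θ j = α := by
  obtain ⟨i, hi⟩ := (e.mem _).mp h
  obtain ⟨m, hm⟩ := cpt_eq_iff.mp hi
  exact ⟨i + m * V.card, by rw [e.per_mul, hm]⟩

lemma q_eq_iff {i j : ℤ} : e.q i = e.q j ↔ ∃ m : ℤ, i = j + m * V.card := by
  rw [q, q, cpt_eq_iff]
  constructor
  · rintro ⟨m, hm⟩
    exact ⟨m, e.mono.injective (by rw [hm, e.per_mul])⟩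
  · rintro ⟨m, rfl⟩
    exact ⟨m, e.per_mul _ _⟩

lemma q_mul (i m : ℤ) : e.q (i + m * V.card) = e.q i := e.q_eq_iff.mpr ⟨m, rfl⟩

lemma exists_lift {z : ℂ} (hz : z ∈ V) (i : ℤ) : ∃ j, i < j ∧ j ≤ i + V.card ∧ e.q j = z := by
  obtain ⟨k, rfl⟩ := (e.mem _).mp hz
  have hp := e.cpos
  refine ⟨k + (-((k - i - 1) / V.card)) * V.card, ?_, ?_, e.q_mul _ _⟩
  · have := Int.emod_add_mul_ediv (k - i - 1) V.card
    have := Int.emod_nonneg (k - i - 1) hp.ne'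
    linarith
  · have := Int.emod_add_mul_ediv (k - i - 1) V.card
    have := Int.emod_lt_of_pos (k - i - 1) hp
    linarith

lemma lift_unique {i j j' : ℤ} (h1 : i < j) (h2 : j ≤ i + V.card) (h3 : i < j')
    (h4 : j' ≤ i + V.card) (h : e.q j = e.q j') : j = j' := by
  obtain ⟨m, hm⟩ := e.q_eq_iff.mp h
  have hp := e.cpos
  have : m = 0 := by
    by_contra hc
    rcases lt_or_gt_of_ne hc with hc | hc <;> nlinarith
  subst this; simpa using hm

lemma q_ne {i j : ℤ} (h1 : i < j) (h2 : j < i + V.card) : e.q i ≠ e.q j := by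
  intro h
  rw [← e.q_add] at h
  have := e.lift_unique (i := i) (by linarith) le_rfl h1 h2.le h
  omega

lemma exists_lift' {z : ℂ} (hz : z ∈ V) (i : ℤ) (hne : z ≠ e.q i) :
    ∃ j, i < j ∧ j < i + V.card ∧ e.q j = z := by
  obtain ⟨j, h1, h2, h3⟩ := e.exists_lift hz i
  refine ⟨j, h1, lt_of_le_of_ne h2 ?_, h3⟩
  rintro rfl
  rw [e.q_add] at h3; exact hne h3.symm

lemma theta_lt {i j : ℤ} (h : j < i + V.card) : e.θ j < e.θ i + 2 * Real.pi := by
  rw [← e.per]; exact e.mono h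
lemma theta_le {i j : ℤ} (h : j ≤ i + V.card) : e.θ j ≤ e.θ i + 2 * Real.pi := by
  rw [← e.per]; exact e.mono.monotone h

lemma posArc_q {i j : ℤ} (h1 : i < j) (h2 : j ≤ i + V.card) :
    posArc (e.q i) (e.q j) = e.θ j - e.θ i := posArc_cpt (e.mono h1) (e.theta_le h2)

lemma posArc_lt {i j k : ℤ} (h1 : i < j) (h2 : j ≤ i + V.card) (h3 : i < k)
    (h4 : k ≤ i + V.card) : posArc (e.q i) (e.q j) < posArc (e.q i) (e.q k) ↔ j < k := by
  rw [e.posArc_q h1 h2, e.posArc_q h3 h4, sub_lt_sub_iff_right, e.mono.lt_iff_lt]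

lemma mem_arcOO {i j k : ℤ} (h1 : i < j) (h2 : j < i + V.card) (h3 : i < k)
    (h4 : k ≤ i + V.card) : e.q k ∈ arcOO (e.q i) (e.q j) ↔ k < j := by
  rw [arcOO, Set.mem_ofPred_eq, e.posArc_lt h3 h4 h1 h2.le]
  constructor
  · exact fun h => h.2.2
  · intro h
    exact ⟨(e.q_ne h3 (by omega)).symm, e.q_ne h (by omega), h⟩

lemma mem_arcCC {i j k : ℤ} (h1 : i < j) (h2 : j < i + V.card) (h3 : i ≤ k)
    (h4 : k < i + V.card) : e.q k ∈ arcCC (e.q i) (e.q j) ↔ k ≤ j := by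
  rw [arcCC, Set.mem_ofPred_eq]
  rcases h3.eq_or_lt with rfl | h3
  · simp [h1.le]
  have n1 := e.q_ne h3 h4
  rw [e.posArc_lt h3 h4.le h1 h2.le]
  constructor
  · rintro (h | h | h)
    · exact (n1 h.symm).elim
    · exact (e.lift_unique h3 h4.le h1 h2.le h).le
    · exact h.2.le
  · intro h
    rcases h.eq_or_lt with rfl | h
    · exact Or.inr (Or.inl rfl)
    · exact Or.inr (Or.inr ⟨n1.symm, h⟩)

lemma acw_iff {a b c : ℤ} (h1 : a < b) (h2 : b < a + V.card) (h3 : b < c)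
    (h4 : c < b + V.card) : ACW (e.q a) (e.q b) (e.q c) ↔ c < a + V.card := by
  rw [ACW]
  constructor
  · rintro ⟨-, -, h5, h6⟩
    by_contra hc
    push Not at hc
    rcases hc.eq_or_lt with hc | hc
    · rw [← hc, e.q_add] at h5; exact h5 rfl
    · rw [← e.q_sub c, e.posArc_lt h1 h2.le (by omega) (by omega)] at h6
      omega
  · intro h
    refine ⟨e.q_ne h1 h2, e.q_ne h3 h4, e.q_ne (h1.trans h3) h, ?_⟩
    rw [e.posArc_lt h1 h2.le (h1.trans h3) h.le]; exact h3

lemma ncard_arc {i j : ℤ} (h1 : i < j) (h2 : j < i + V.card) :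
    (((V : Set ℂ) ∩ arcOO (e.q i) (e.q j)).ncard : ℤ) + 1 = j - i := by
  have : (V : Set ℂ) ∩ arcOO (e.q i) (e.q j) = e.q '' Set.Ioo i j := by
    ext z
    constructor
    · rintro ⟨hz, hz'⟩
      obtain ⟨k, hk1, hk2, rfl⟩ := e.exists_lift hz i
      rw [e.mem_arcOO h1 h2 hk1 hk2] at hz'
      exact ⟨k, ⟨hk1, hz'⟩, rfl⟩
    · rintro ⟨k, ⟨hk1, hk2⟩, rfl⟩
      exact ⟨e.q_mem k, (e.mem_arcOO h1 h2 hk1 (by omega)).mpr hk2⟩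
  rw [this, Set.InjOn.ncard_image]
  · rw [← Finset.coe_Ioo, Set.ncard_coe_finset, Int.card_Ioo]; omega
  · intro x hx y hy hxy
    exact e.lift_unique hx.1 (by have := hx.2; omega) hy.1 (by have := hy.2; omega) hxy

lemma vangle_q {x y z : ℤ} (h1 : y < x) (h2 : x < y + V.card) (h3 : y < z)
    (h4 : z < y + V.card) : vangle (e.q x) (e.q y) (e.q z) = |e.θ x - e.θ z| / 2 :=
  vangle_cpt (e.mono h1) (e.theta_lt h2) (e.mono h3) (e.theta_lt h4)

lemma vangle_pos {x y z : ℤ} (h1 : y < x) (h2 : x < y + V.card) (h3 : y < z)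
    (h4 : z < y + V.card) : 0 < vangle (e.q x) (e.q y) (e.q z) ↔ x ≠ z := by
  rw [e.vangle_q h1 h2 h3 h4]
  constructor
  · rintro h rfl; simp at h
  · intro h
    have : 0 < |e.θ x - e.θ z| := abs_pos.mpr (sub_ne_zero.mpr (e.mono.injective.ne h))
    linarith

/-- angle at `v` between `u` (incoming) and `w` (outgoing) split by `x` -/
lemma splits_iff {u v w x : ℤ} (h1 : v < w) (h2 : w ≤ u) (h3 : u < v + V.card) (h4 : v < x)
    (h5 : x < v + V.card) :
    (0 < vangle (e.q u) (e.q v) (e.q x) ∧ 0 < vangle (e.q x) (e.q v) (e.q w) ∧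
      vangle (e.q u) (e.q v) (e.q x) + vangle (e.q x) (e.q v) (e.q w) =
        vangle (e.q u) (e.q v) (e.q w)) ↔ w < x ∧ x < u := by
  have g1 := h1.trans_le h2
  have g2 := h2.trans_lt h3
  rw [e.vangle_pos g1 h3 h4 h5, e.vangle_pos h4 h5 h1 g2, e.vangle_q g1 h3 h4 h5,
    e.vangle_q h4 h5 h1 g2, e.vangle_q g1 h3 h1 g2]
  have hm := e.mono.monotone h2
  rw [abs_of_nonneg (by linarith : 0 ≤ e.θ u - e.θ w)]
  constructor
  · rintro ⟨a1, a2, a3⟩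
    by_contra hc
    have : x < w ∨ u < x := by omega
    rcases this with hx | hx
    · have b1 := e.mono hx
      rw [abs_of_pos (by linarith), abs_of_neg (by linarith)] at a3
      linarith
    · have b1 := e.mono hx
      rw [abs_of_neg (by linarith), abs_of_pos (by linarith)] at a3
      linarith
  · rintro ⟨a1, a2⟩
    have b1 := e.mono a1
    have b2 := e.mono a2
    refine ⟨a2.ne', a1.ne', ?_⟩
    rw [abs_of_pos (by linarith), abs_of_pos (by linarith)]; ring

end CEnum

/-! ### From polygons to nets -/

namespace CyclicPolygon
variable (P : CyclicPolygon)

/-- a chosen cyclic enumeration of the vertices -/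
def en : CEnum P.V := (exists_cenum P.V P.nonempty P.onCircle).some

lemma mem_of_edge {u v : ℂ} (h : (u, v) ∈ P.E) : u ∈ P.V ∧ v ∈ P.V := P.endmem _ h

lemma edge_ne {u v : ℂ} (h : (u, v) ∈ P.E) : u ≠ v := by
  obtain ⟨w, hw, -⟩ := P.outdeg v (P.mem_of_edge h).2
  exact (P.acw u v w h hw).1

lemma out_unique {u v w : ℂ} (h : (u, v) ∈ P.E) (h' : (u, w) ∈ P.E) : v = w :=
  (P.outdeg u (P.mem_of_edge h).1).unique h h'
lemma in_unique {u v w : ℂ} (h : (v, u) ∈ P.E) (h' : (w, u) ∈ P.E) : v = w :=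
  (P.indeg u (P.mem_of_edge h).2).unique h h'

lemma next_eq {u v : ℂ} (h : (u, v) ∈ P.E) : P.next u = v := by
  have hh : ∃ w, (u, w) ∈ P.E := ⟨v, h⟩
  rw [next, dif_pos hh]
  exact P.out_unique hh.choose_spec h
lemma prev_eq {u v : ℂ} (h : (u, v) ∈ P.E) : P.prev v = u := by
  have hh : ∃ w, (w, v) ∈ P.E := ⟨u, h⟩
  rw [prev, dif_pos hh]
  exact P.in_unique hh.choose_spec h

section
variable {P}
variable (e : CEnum P.V)

lemma exists_nx (i : ℤ) : ∃ j, i < j ∧ j < i + P.V.card ∧ (e.q i, e.q j) ∈ P.E := by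
  obtain ⟨w, hw, -⟩ := P.outdeg _ (e.q_mem i)
  obtain ⟨j, h1, h2, rfl⟩ := e.exists_lift' (P.mem_of_edge hw).2 i (P.edge_ne hw).symm
  exact ⟨j, h1, h2, hw⟩

lemma exists_pv (i : ℤ) : ∃ j, j < i ∧ i < j + P.V.card ∧ (e.q j, e.q i) ∈ P.E := by
  obtain ⟨w, hw, -⟩ := P.indeg _ (e.q_mem i)
  obtain ⟨j, h1, h2, rfl⟩ := e.exists_lift' (P.mem_of_edge hw).1 i (P.edge_ne hw)
  exact ⟨j - P.V.card, by omega, by omega, by rwa [e.q_sub]⟩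

/-- index successor -/
def nxi (i : ℤ) : ℤ := (exists_nx e i).choose
def pvi (i : ℤ) : ℤ := (exists_pv e i).choose
lemma nxi_spec (i : ℤ) : i < nxi e i ∧ nxi e i < i + P.V.card ∧ (e.q i, e.q (nxi e i)) ∈ P.E :=
  (exists_nx e i).choose_spec
lemma pvi_spec (i : ℤ) : pvi e i < i ∧ i < pvi e i + P.V.card ∧ (e.q (pvi e i), e.q i) ∈ P.E :=
  (exists_pv e i).choose_spec

lemma eq_nxi {i j : ℤ} (h1 : i < j) (h2 : j < i + P.V.card) (h : (e.q i, e.q j) ∈ P.E) :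
    j = nxi e i := by
  obtain ⟨a1, a2, a3⟩ := nxi_spec e i
  exact e.lift_unique h1 h2.le a1 a2.le (P.out_unique h a3)
lemma eq_pvi {i j : ℤ} (h1 : j < i) (h2 : i < j + P.V.card) (h : (e.q j, e.q i) ∈ P.E) :
    j = pvi e i := by
  obtain ⟨a1, a2, a3⟩ := pvi_spec e i
  exact e.lift_unique (i := i - P.V.card) (by omega) (by omega) (by omega) (by omega)
    (P.in_unique h a3)

/-- the net of a cyclic polygon -/
def net : PNet where
  n := P.V.card
  nx := nxi e
  pv := pvi e
  nx_pv i := by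
    obtain ⟨a1, a2, a3⟩ := pvi_spec e i
    exact (eq_nxi e a1 a2 a3).symm
  pv_nx i := by
    obtain ⟨a1, a2, a3⟩ := nxi_spec e i
    exact (eq_pvi e a1 a2 a3).symm
  lt_nx i := (nxi_spec e i).1
  acw i := by
    obtain ⟨a1, a2, a3⟩ := nxi_spec e i
    obtain ⟨b1, b2, b3⟩ := pvi_spec e i
    exact (e.acw_iff b1 b2 a1 a2).mp (P.acw _ _ _ b3 a3)
  nx_add i := by
    obtain ⟨a1, a2, a3⟩ := nxi_spec e i
    refine (eq_nxi e (by omega) (by omega) ?_).symm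
    rwa [e.q_add, e.q_add]

lemma net_n : (net e).n = P.V.card := rfl

lemma edge_iff {i j : ℤ} (h1 : i < j) (h2 : j < i + P.V.card) :
    (e.q i, e.q j) ∈ P.E ↔ j = (net e).nx i := by
  constructor
  · exact eq_nxi e h1 h2
  · rintro rfl; exact (nxi_spec e i).2.2

lemma edge_iff' {i j : ℤ} (h1 : i < j) (h2 : j < i + P.V.card) :
    (e.q j, e.q i) ∈ P.E ↔ j = (net e).pv i + P.V.card := by
  rw [← e.q_sub j]
  constructor
  · intro h
    have := eq_pvi e (j := j - P.V.card) (by omega) (by omega) h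
    have h2 : (net e).pv i = pvi e i := rfl
    omega
  · rintro rfl
    rw [add_sub_cancel_right]; exact (pvi_spec e i).2.2

lemma nx_lt (i : ℤ) : (net e).nx i < i + P.V.card := (nxi_spec e i).2.1
lemma lt_pv (i : ℤ) : i < (net e).pv i + P.V.card := (pvi_spec e i).2.1
lemma nx_edge (i : ℤ) : (e.q i, e.q ((net e).nx i)) ∈ P.E := (nxi_spec e i).2.2
lemma pv_edge (i : ℤ) : (e.q ((net e).pv i), e.q i) ∈ P.E := (pvi_spec e i).2.2

lemma splitsVertex_iff {a b : ℤ} (h1 : a < b) (h2 : b < a + P.V.card) :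
    SplitsVertexAngle P (e.q a) (e.q b) ↔
      (net e).nx a < b ∧ b < (net e).pv a + P.V.card := by
  rw [SplitsVertexAngle, P.prev_eq (pv_edge e a), P.next_eq (nx_edge e a), ← e.q_add ((net e).pv a)]
  have h5 := (net e).acw a
  have h6 := lt_pv e a
  have h7 := (net e).pv_lt a
  have h8 := (net e).lt_nx a
  have h9 := nx_lt e a
  rw [net_n] at h5
  rw [e.splits_iff (by omega) h5.le (by omega) h1 h2]
  exact ⟨fun h => h.2, fun h => ⟨e.q_mem a, h⟩⟩

lemma linkable_symm {u v : ℂ} : Linkable P u v ↔ Linkable P v u := by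
  rw [Linkable, Linkable, LinkablePair, LinkablePair, ne_comm]; tauto

lemma linkable_iff {a b : ℤ} (h1 : a < b) (h2 : b < a + P.V.card) :
    Linkable P (e.q a) (e.q b) ↔ (a, b) ∈ (net e).L := by
  rw [Linkable, LinkablePair, splitsVertex_iff e h1 h2, ← e.q_add a,
    splitsVertex_iff e h2 (by omega), PNet.L, Set.mem_ofPred_eq, net_n, e.q_add]
  have := e.q_ne h1 h2
  simp only [ne_eq, this, not_false_eq_true, true_and]
  omega

lemma L_bounds {a b : ℤ} (h : (a, b) ∈ (net e).L) : a < b ∧ b < a + P.V.card := by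
  rw [PNet.L, Set.mem_ofPred_eq] at h
  have h1 := (net e).lt_nx a
  have h2 := (net e).lt_nx b
  rw [net_n] at h
  simp only at h
  omega
end
end CyclicPolygon

namespace PNet
variable (N : PNet)

lemma gp_even (m : ℤ) (p : ℤ × ℤ) : (N.gp ^ (2 * m)) p = (p.1 - m * N.n, p.2 - m * N.n) := by
  induction m using Int.induction_on generalizing p with
  | zero => simp
  | succ m ih =>
    rw [show 2 * ((m : ℤ) + 1) = 2 * m + 1 + 1 by ring, zpow_add_one, zpow_add_one,
      Equiv.Perm.mul_apply, Equiv.Perm.mul_apply, ih]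
    simp only [gp_apply, Prod.mk.injEq]; constructor <;> ring
  | pred m ih =>
    have e : (p.1, p.2) = N.gp (N.gp (p.1 + N.n, p.2 + N.n)) := by simp
    have e' : p = N.gp (N.gp (p.1 + N.n, p.2 + N.n)) := e
    rw [e', ← Equiv.Perm.mul_apply, ← Equiv.Perm.mul_apply, ← zpow_add_one,
      ← zpow_add_one,
      show 2 * (-(m : ℤ) - 1) + 1 + 1 = 2 * -m by ring, ih]
    simp only [gp_apply, Prod.mk.injEq]; constructor <;> ring
end PNet

namespace CyclicPolygon
variable {P : CyclicPolygon} (e : CEnum P.V)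

/-- the chord of a lattice point -/
def sv (p : ℤ × ℤ) : Sym2 ℂ := s(e.q p.1, e.q p.2)

lemma sv_gp (p : ℤ × ℤ) : sv e ((net e).gp p) = sv e p := by
  simp only [sv, PNet.gp_apply, net_n, e.q_sub]; exact Sym2.eq_swap

lemma sv_zpow (m : ℤ) (p : ℤ × ℤ) : sv e (((net e).gp ^ m) p) = sv e p := by
  induction m using Int.induction_on generalizing p with
  | zero => simp
  | succ m ih => rw [zpow_add_one, Equiv.Perm.mul_apply, ih, sv_gp]
  | pred m ih =>
    rw [zpow_sub_one, Equiv.Perm.mul_apply, ih, ← sv_gp e, perm_apply_inv]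

/-- lattice points in the strip -/
def strip : Set (ℤ × ℤ) := {p | p.1 < p.2 ∧ p.2 < p.1 + P.V.card}

lemma sv_eq_iff {r p : ℤ × ℤ} (hr : r ∈ strip (P := P)) (hp : p ∈ strip (P := P)) :
    sv e r = sv e p ↔ r ∈ (net e).Orb p := by
  constructor
  · obtain ⟨a, b⟩ := r
    obtain ⟨c, d⟩ := p
    simp only [strip, Set.mem_ofPred_eq] at hr hp
    intro h
    rw [sv, sv, Sym2.eq_iff] at h
    rcases h with ⟨h1, h2⟩ | ⟨h1, h2⟩
    · obtain ⟨m, rfl⟩ := e.q_eq_iff.mp h1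
      have : b = d + m * P.V.card := by
        refine e.lift_unique hr.1 hr.2.le (by linarith) (by linarith) ?_
        rw [e.q_mul]; exact h2
      subst this
      refine ⟨2 * (-m), ?_⟩
      rw [PNet.gp_even]; simp [net_n]
    · obtain ⟨m, rfl⟩ := e.q_eq_iff.mp h1
      have : b = c + (m + 1) * P.V.card := by
        refine e.lift_unique hr.1 hr.2.le (by linarith) (by linarith) ?_
        rw [e.q_mul]; exact h2
      subst this
      refine ⟨2 * (-m - 1) + 1, ?_⟩
      rw [zpow_add_one, Equiv.Perm.mul_apply, PNet.gp_even]
      simp only [net_n, PNet.gp_apply, Prod.mk.injEq]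
      constructor <;> ring
  · rintro ⟨m, hm⟩
    rw [hm, sv_zpow]

def lift (D : Set (Sym2 ℂ)) : Set (ℤ × ℤ) := {p | p ∈ strip (P := P) ∧ sv e p ∈ D}
def back (Dl : Set (ℤ × ℤ)) : Set (Sym2 ℂ) := {z | ∃ p ∈ Dl, z = sv e p}

lemma L_strip : (net e).L ⊆ strip (P := P) := fun _ hp => L_bounds e hp

lemma lift_valid {D : Set (Sym2 ℂ)} (hD : IsDiagonalSet P D) : (net e).Valid (lift e D) := by
  constructor
  · rintro ⟨a, b⟩ ⟨h1, h2⟩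
    exact (linkable_iff e h1.1 h1.2).mp (hD _ _ h2)
  · intro p
    simp only [lift, Set.mem_ofPred_eq, sv_gp]
    simp only [strip, Set.mem_ofPred_eq, PNet.gp_apply, net_n]
    have : p.2 - P.V.card < p.1 ∧ p.1 < p.2 - P.V.card + P.V.card ↔
      p.1 < p.2 ∧ p.2 < p.1 + P.V.card := by omega
    rw [this]

lemma back_diag {Dl : Set (ℤ × ℤ)} (hD : (net e).Valid Dl) : IsDiagonalSet P (back e Dl) := by
  rintro u v ⟨⟨a, b⟩, hp, h⟩
  have hL := hD.sub hp
  have hb := L_bounds e hL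
  rw [← linkable_iff e hb.1 hb.2] at hL
  rw [sv, Sym2.eq_iff] at h
  rcases h with ⟨rfl, rfl⟩ | ⟨rfl, rfl⟩
  · exact hL
  · exact linkable_symm.mp hL

lemma back_lift {D : Set (Sym2 ℂ)} (hD : IsDiagonalSet P D) : back e (lift e D) = D := by
  ext z
  constructor
  · rintro ⟨p, hp, rfl⟩; exact hp.2
  · induction z using Sym2.ind with
    | _ u v =>
      intro h
      have hl := hD _ _ h
      obtain ⟨i, -, -, rfl⟩ := e.exists_lift hl.2.1.1 0
      obtain ⟨j, h1, h2, rfl⟩ := e.exists_lift' hl.2.2.1 i hl.1.symm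
      exact ⟨(i, j), ⟨⟨h1, h2⟩, h⟩, rfl⟩

lemma lift_back {Dl : Set (ℤ × ℤ)} (hD : (net e).Valid Dl) : lift e (back e Dl) = Dl := by
  ext p
  constructor
  · rintro ⟨h1, r, hr, h2⟩
    obtain ⟨m, hm⟩ := (sv_eq_iff e h1 (L_strip e (hD.sub hr))).mp h2
    rw [hm, (net e).inv_zpow hD.inv]; exact hr
  · intro hp
    exact ⟨L_strip e (hD.sub hp), p, hp, rfl⟩

lemma lift_mono {D D' : Set (Sym2 ℂ)} (h : D ⊆ D') : lift e D ⊆ lift e D' :=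
  fun _ hp => ⟨hp.1, h hp.2⟩
lemma back_mono {D D' : Set (ℤ × ℤ)} (h : D ⊆ D') : back e D ⊆ back e D' :=
  fun _ ⟨p, hp, hz⟩ => ⟨p, h hp, hz⟩

lemma flipStep_back {Dl : Set (ℤ × ℤ)} (hD : (net e).Valid Dl) {p₁ p₂ : ℤ × ℤ} (h1 : p₁ ∈ Dl)
    (h2 : p₂ ∉ Dl) (h3 : p₂ ∈ (net e).L) :
    FlipStep (back e Dl) (back e ((net e).tog Dl p₁ p₂)) := by
  have hO1 : ∀ r, r ∈ (net e).Orb p₁ → r ∈ Dl := by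
    rintro r ⟨m, rfl⟩; rw [(net e).inv_zpow hD.inv]; exact h1
  have hO2 : ∀ r, r ∈ (net e).Orb p₂ → r ∉ Dl := by
    rintro r ⟨m, rfl⟩; rw [(net e).inv_zpow hD.inv]; exact h2
  have s1 := L_strip e (hD.sub h1)
  have s2 := L_strip e h3
  refine ⟨sv e p₁, sv e p₂, ⟨p₁, h1, rfl⟩, ?_, ?_⟩
  · rintro ⟨r, hr, h⟩
    exact hO2 r ((sv_eq_iff e (L_strip e (hD.sub hr)) s2).mp h.symm) hr
  · ext z
    constructor
    · rintro ⟨r, hr, rfl⟩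
      by_cases hr1 : r ∈ (net e).Orb p₁
      · rw [PNet.tog_mem_self _ (Or.inl hr1)] at hr
        exact (hr (hO1 r hr1)).elim
      by_cases hr2 : r ∈ (net e).Orb p₂
      · right; obtain ⟨m, rfl⟩ := hr2; exact sv_zpow e m p₂
      · rw [PNet.tog_mem_other _ (by tauto)] at hr
        left
        refine ⟨⟨r, hr, rfl⟩, ?_⟩
        intro h
        exact hr1 ((sv_eq_iff e (L_strip e (hD.sub hr)) s1).mp h)
    · rintro (⟨⟨r, hr, rfl⟩, h⟩ | h)
      · refine ⟨r, ?_, rfl⟩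
        rw [PNet.tog_mem_other]
        · exact hr
        · rintro (h' | h')
          · exact h ((sv_eq_iff e (L_strip e (hD.sub hr)) s1).mpr h')
          · exact hO2 r h' hr
      · exact ⟨p₂, (PNet.tog_mem_self _ (Or.inr ((net e).self_mem_orb p₂))).mpr h2, h⟩

end CyclicPolygon

namespace PNet
variable (N : PNet) {D : Set (ℤ × ℤ)}

lemma free_row {a b : ℤ} (m : ℕ) (h : ∀ c, a - m ≤ c → c < a → (c, b) ∉ N.K D) :
    (N.step D ^ m) ⟨a, b, true⟩ = ⟨a - m, b, true⟩ := by
  induction m with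
  | zero => simp
  | succ m ih =>
    rw [pow_succ_step, ih (fun c h1 h2 => h c (by push_cast; omega) h2), step_left,
      if_neg (h _ (by push_cast; omega) (by omega))]
    congr 1; push_cast; ring

lemma row_turn {a a' b : ℤ} (h1 : a' < a) (h : ∀ c, a' < c → c < a → (c, b) ∉ N.K D)
    (hk : (a', b) ∈ N.K D) : (N.step D ^ (a - a').toNat) ⟨a, b, true⟩ = ⟨a', b, false⟩ := by
  obtain ⟨m, hm⟩ : ∃ m : ℕ, (a - a').toNat = m + 1 := ⟨(a - a').toNat - 1, by omega⟩
  rw [hm, pow_succ_step, N.free_row m (fun c h1 h2 => h c (by omega) h2), step_left,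
    show a - m - 1 = a' by omega, if_pos hk]

lemma free_col {a b : ℤ} (m : ℕ) (h : ∀ c, b - m ≤ c → c < b → (a, c) ∉ N.K D) :
    (N.step D ^ m) ⟨a, b, false⟩ = ⟨a, b - m, false⟩ := by
  induction m with
  | zero => simp
  | succ m ih =>
    rw [pow_succ_step, ih (fun c h1 h2 => h c (by push_cast; omega) h2), step_down,
      if_neg (h _ (by push_cast; omega) (by omega))]
    congr 1; push_cast; ring

lemma col_turn {a b b' : ℤ} (h1 : b' < b) (h : ∀ c, b' < c → c < b → (a, c) ∉ N.K D)
    (hk : (a, b') ∈ N.K D) : (N.step D ^ (b - b').toNat) ⟨a, b, false⟩ = ⟨a, b', true⟩ := by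
  obtain ⟨m, hm⟩ : ∃ m : ℕ, (b - b').toNat = m + 1 := ⟨(b - b').toNat - 1, by omega⟩
  rw [hm, pow_succ_step, N.free_col m (fun c h1 h2 => h c (by omega) h2), step_down,
    show b - m - 1 = b' by omega, if_pos hk]

lemma exists_dart {a b : ℤ} (hx : N.InX ⟨a, b, true⟩) : ∃ a₀, a ≤ a₀ ∧ (a₀, b) ∈ N.K D ∧
    N.InX ⟨a₀, b, true⟩ ∧ (N.step D ^ (a₀ - a).toNat) ⟨a₀, b, true⟩ = ⟨a, b, true⟩ := by
  rw [inX_left] at hx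
  obtain ⟨a₀, ⟨h1, h2⟩, h3⟩ := Int.exists_least_of_bdd (P := fun c => a ≤ c ∧ (c, b) ∈ N.K D)
    ⟨a, fun z hz => hz.1⟩ ⟨N.pv b, hx.2, Or.inr (Or.inl (by simp only [N.nx_pv]))⟩
  have h4 := h3 (N.pv b) ⟨hx.2, Or.inr (Or.inl (by simp only [N.nx_pv]))⟩
  refine ⟨a₀, h1, h2, ?_, ?_⟩
  · rw [inX_left]; omega
  · rw [N.free_row]
    · congr 1; omega
    · intro c hc1 hc2 hc3
      have := h3 c ⟨by omega, hc3⟩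
      omega

lemma close_of_reach {x : PSt} {m : ℕ} (h : (N.step D ^ m) x = N.g x) :
    (N.step D ^ N.n) x = N.g x := by
  have h1 := congrArg PSt.time h
  rw [time_pow, time_g] at h1
  have : m = N.n := by omega
  rwa [this] at h

lemma close_of_pow (hv : N.Valid D) {x y : PSt} (h : (N.step D ^ N.n) x = N.g x) (j : ℕ)
    (hy : (N.step D ^ j) x = y) : (N.step D ^ N.n) y = N.g y := by
  rw [← hy, ← Equiv.Perm.mul_apply, ← pow_add, add_comm, pow_add, Equiv.Perm.mul_apply, h]
  have := N.zpow_g hv j x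
  rwa [zpow_natCast] at this

end PNet

namespace CyclicPolygon
variable {P : CyclicPolygon} (e : CEnum P.V)

/-- sub-enumeration -/
lemma exists_sub (S : CyclicPolygon) (e' : CEnum S.V) (h : (S.V : Set ℂ) ⊆ P.V) :
    ∃ p : ℤ → ℤ, StrictMono p ∧ (∀ i, p (i + S.V.card) = p i + P.V.card) ∧
      ∀ i, e.q (p i) = e'.q i := by
  have : ∀ i, ∃ j, e.θ j = e'.θ i := fun i => e.exists_theta (h (e'.q_mem i))
  choose p hp using this
  refine ⟨p, ?_, ?_, ?_⟩
  · intro i j hij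
    rw [← e.mono.lt_iff_lt, hp, hp]; exact e'.mono hij
  · intro i
    apply e.mono.injective
    rw [hp, e'.per, e.per, hp]
  · intro i; rw [CEnum.q, CEnum.q, hp]

/-- index form of a `k`-star inside `P` -/
structure StarIx (S : CyclicPolygon) (k : ℕ) (p : ℤ → ℤ) : Prop where
  kpos : 0 < k
  card : S.V.card = 2 * k + 1
  mono : StrictMono p
  per : ∀ i, p (i + (2 * k + 1)) = p i + P.V.card
  edge : ∀ i, (e.q (p i), e.q (p (i + k))) ∈ S.E
  of_edge : ∀ z ∈ S.E, ∃ i, z = (e.q (p i), e.q (p (i + k)))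
  mem : ∀ z, z ∈ S.V ↔ ∃ i, z = e.q (p i)

lemma exists_starIx {S : CyclicPolygon} (hS : IsStar S) (h : (S.V : Set ℂ) ⊆ P.V) :
    ∃ k p, StarIx e S k p := by
  obtain ⟨k, hk, hc, hE⟩ := hS
  obtain ⟨p, hp1, hp2, hp3⟩ := exists_sub e S S.en h
  have hnx : ∀ i, (net S.en).nx i = i + k := by
    intro i
    have h1 := hE _ (nx_edge S.en i)
    have h2 := S.en.ncard_arc ((net S.en).lt_nx i) (nx_lt S.en i)
    simp only [edgeLength] at h1
    omega
  refine ⟨k, p, hk, hc, hp1, ?_, ?_, ?_, ?_⟩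
  · intro i; rw [← hp2, hc]; push_cast; rfl
  · intro i
    rw [hp3, hp3, ← hnx]; exact nx_edge S.en i
  · rintro ⟨u, v⟩ hz
    obtain ⟨i, -, -, rfl⟩ := S.en.exists_lift (S.mem_of_edge hz).1 0
    refine ⟨i, ?_⟩
    rw [hp3, hp3, ← hnx, S.out_unique hz (nx_edge S.en i)]
  · intro z
    rw [S.en.mem]
    simp only [hp3]; rfl

lemma dart_iff {D : Set (Sym2 ℂ)} {a b : ℤ} (h1 : a < b)
    (h2 : b < a + P.V.card) : (e.q a, e.q b) ∈ (P.E : Set (ℂ × ℂ)) ∪ tilde D ↔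
      b = (net e).nx a ∨ (a, b) ∈ lift e D := by
  rw [Set.mem_union, Finset.mem_coe, edge_iff e h1 h2]
  have : (e.q a, e.q b) ∈ tilde D ↔ (a, b) ∈ lift e D :=
    ⟨fun h => ⟨⟨h1, h2⟩, h⟩, fun h => h.2⟩
  rw [this]

lemma dart_iff' {D : Set (Sym2 ℂ)} {a b : ℤ} (h1 : a < b)
    (h2 : b < a + P.V.card) : (e.q b, e.q a) ∈ (P.E : Set (ℂ × ℂ)) ∪ tilde D ↔
      b = (net e).pv a + P.V.card ∨ (a, b) ∈ lift e D := by
  rw [Set.mem_union, Finset.mem_coe, edge_iff' e h1 h2]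
  have : (e.q b, e.q a) ∈ tilde D ↔ (a, b) ∈ lift e D :=
    ⟨fun h => ⟨⟨h1, h2⟩, by rw [sv, Sym2.eq_swap]; exact h⟩,
      fun h => by have := h.2; rw [sv, Sym2.eq_swap] at this; exact this⟩
  rw [this]

/-- darts are left steps at turning points -/
lemma dart_inX {Dl : Set (ℤ × ℤ)} (hD : (net e).Valid Dl) {a b : ℤ} (_ : a < b)
    (_ : b < a + P.V.card) : (b = (net e).nx a ∨ (a, b) ∈ Dl) ↔
      (a, b) ∈ (net e).K Dl ∧ (net e).InX ⟨a, b, true⟩ := by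
  have h3 := (net e).acw b
  have e4 := (net e).eq_pv_iff (a := a) (b := b)
  rw [PNet.inX_left]
  simp only [PNet.K, Set.mem_ofPred_eq]
  constructor
  · rintro (h | h)
    · have := (net e).eq_nx_iff.mp h
      exact ⟨Or.inr (Or.inl h), by omega, by omega⟩
    · have hL := hD.sub h
      simp only [PNet.L, Set.mem_ofPred_eq] at hL
      exact ⟨Or.inl h, by omega, by omega⟩
  · rintro ⟨h | h | h, h5, h6⟩
    · exact Or.inr h
    · exact Or.inl h
    · rw [e4] at h; omega

lemma StarIx.bounds {S : CyclicPolygon} {k : ℕ} {p : ℤ → ℤ} (st : StarIx e S k p) (i : ℤ) :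
    p i < p (i + k) ∧ p (i + k) < p i + P.V.card := by
  have := st.kpos
  rw [← st.per]
  exact ⟨st.mono (by omega), st.mono (by omega)⟩

lemma StarIx.wrap {S : CyclicPolygon} {k : ℕ} {p : ℤ → ℤ} (st : StarIx e S k p) (i : ℤ) :
    p (i + k + k) = p (i - 1) + P.V.card := by
  rw [← st.per]; congr 1; ring

lemma star_row_free {D : Set (Sym2 ℂ)} {𝒮 : Finset CyclicPolygon} (h : IsStarDecomp P D 𝒮)
    {S : CyclicPolygon} (hS : S ∈ 𝒮) {k : ℕ} {p : ℤ → ℤ} (st : StarIx e S k p) (i c : ℤ)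
    (h1 : p (i - 1) < c) (h2 : c < p i) : (c, p (i + k)) ∉ (net e).K (lift e D) := by
  obtain ⟨hD, -, hE, -, -, hsp⟩ := h
  have b1 := st.bounds e i
  have b2 := st.bounds e (i + k)
  have w := st.wrap e i
  have hV := lift_valid e hD
  have d1 : (e.q (p i), e.q (p (i + k))) ∈ (P.E : Set (ℂ × ℂ)) ∪ tilde D := hE S hS (st.edge i)
  have d2 : (e.q (p (i + k)), e.q (p (i - 1))) ∈ (P.E : Set (ℂ × ℂ)) ∪ tilde D := by
    have := hE S hS (st.edge (i + k)); rwa [w, e.q_add] at this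
  rw [dart_iff e b1.1 b1.2, dart_inX e hV b1.1 b1.2, PNet.inX_left] at d1
  rw [dart_iff' e (by omega) (by omega)] at d2
  have hnx : (net e).nx (p (i + k)) ≤ p (i - 1) + P.V.card := by
    rcases d2 with d2 | d2
    · have := (net e).eq_pv_iff.mp d2; rw [net_n] at this; omega
    · have := hV.sub d2
      simp only [PNet.L, Set.mem_ofPred_eq, net_n] at this; omega
  rintro (hk | hk | hk)
  · apply hsp S hS _ _ _ (st.edge i) (st.edge (i + k))
    refine ⟨e.q c, ?_, ?_⟩
    · have := hk.2; rw [sv, Sym2.eq_swap] at this; exact this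
    · rw [SplitsAngle3, ← e.q_add (p i), ← e.q_add c,
        e.splits_iff (by omega) (by omega) (by omega) (by omega) (by omega)]
      omega
  · have := (net e).eq_nx_iff.mp hk; simp only at this; omega
  · have := (net e).eq_pv_iff.mp hk
    simp only [net_n] at this
    omega

lemma star_step {D : Set (Sym2 ℂ)} {𝒮 : Finset CyclicPolygon} (h : IsStarDecomp P D 𝒮)
    {S : CyclicPolygon} (hS : S ∈ 𝒮) {k : ℕ} {p : ℤ → ℤ} (st : StarIx e S k p) (i : ℤ) :
    ∃ m, ((net e).step (lift e D) ^ m) ⟨p i, p (i + k), true⟩ = ⟨p (i - 1), p (i + k), false⟩ := by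
  have b1 := st.bounds e i
  have b2 := st.bounds e (i + k)
  have w := st.wrap e i
  have d2 : (e.q (p (i + k)), e.q (p (i - 1))) ∈ (P.E : Set (ℂ × ℂ)) ∪ tilde D := by
    have := h.2.2.1 S hS (st.edge (i + k)); rwa [w, e.q_add] at this
  rw [dart_iff' e (by omega) (by omega)] at d2
  refine ⟨_, (net e).row_turn (st.mono (by omega))
    (fun c h1 h2 => star_row_free e h hS st i c h1 h2) ?_⟩
  rcases d2 with d2 | d2
  · exact Or.inr (Or.inr d2)
  · exact Or.inl d2

lemma star_step' {D : Set (Sym2 ℂ)} {𝒮 : Finset CyclicPolygon} (h : IsStarDecomp P D 𝒮)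
    {S : CyclicPolygon} (hS : S ∈ 𝒮) {k : ℕ} {p : ℤ → ℤ} (st : StarIx e S k p) (i : ℤ) :
    ∃ m, ((net e).step (lift e D) ^ m) ⟨p (i - 1), p (i + k), false⟩ =
      ⟨p (i - 1), p (i - 1 + k), true⟩ := by
  have w := st.wrap e i
  have hV := lift_valid e h.1
  have b1 := st.bounds e (i - 1)
  refine ⟨_, (net e).col_turn (st.mono (by omega)) ?_ ?_⟩
  · intro c h1 h2 hk
    refine star_row_free e h hS st (i + k) c ?_ h2 ?_
    · rw [show i + k - 1 = i - 1 + k by ring]; exact h1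
    · rw [w, ← (net e).K_inv hV]; simpa [net_n] using hk
  · have d1 : (e.q (p (i - 1)), e.q (p (i - 1 + k))) ∈ (P.E : Set (ℂ × ℂ)) ∪ tilde D :=
      h.2.2.1 S hS (st.edge (i - 1))
    rw [dart_iff e b1.1 b1.2, dart_inX e hV b1.1 b1.2] at d1
    exact d1.1

lemma star_steps {D : Set (Sym2 ℂ)} {𝒮 : Finset CyclicPolygon} (h : IsStarDecomp P D 𝒮)
    {S : CyclicPolygon} (hS : S ∈ 𝒮) {k : ℕ} {p : ℤ → ℤ} (st : StarIx e S k p) (i : ℤ) (j : ℕ) :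
    ∃ m, ((net e).step (lift e D) ^ m) ⟨p i, p (i + k), true⟩ = ⟨p (i - j), p (i - j + k), true⟩ := by
  induction j with
  | zero => exact ⟨0, by simp⟩
  | succ j ih =>
    obtain ⟨m, hm⟩ := ih
    obtain ⟨m1, hm1⟩ := star_step e h hS st (i - j)
    obtain ⟨m2, hm2⟩ := star_step' e h hS st (i - j)
    refine ⟨m2 + (m1 + m), ?_⟩
    rw [pow_add, pow_add, Equiv.Perm.mul_apply, Equiv.Perm.mul_apply, hm, hm1, hm2]
    rw [show i - (j + 1 : ℕ) = i - j - 1 by push_cast; ring]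

lemma star_close {D : Set (Sym2 ℂ)} {𝒮 : Finset CyclicPolygon} (h : IsStarDecomp P D 𝒮)
    {S : CyclicPolygon} (hS : S ∈ 𝒮) {k : ℕ} {p : ℤ → ℤ} (st : StarIx e S k p) (i : ℤ) :
    ((net e).step (lift e D) ^ (net e).n) ⟨p i, p (i + k), true⟩ =
      (net e).g ⟨p i, p (i + k), true⟩ := by
  obtain ⟨m, hm⟩ := star_steps e h hS st i k
  obtain ⟨m1, hm1⟩ := star_step e h hS st (i - k)
  refine (net e).close_of_reach (m := m1 + m) ?_
  rw [pow_add, Equiv.Perm.mul_apply, hm, hm1]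
  have := st.per (i - k - 1)
  rw [show i - (k : ℤ) - 1 + (2 * k + 1) = i + k by ring] at this
  have e2 : p (i - k - 1) = p (i + k) - P.V.card := by omega
  rw [e2, show i - (k : ℤ) + k = i by ring]
  rfl

lemma lift_good {D : Set (Sym2 ℂ)} {𝒮 : Finset CyclicPolygon} (h : IsStarDecomp P D 𝒮) :
    (net e).Good (lift e D) := by
  have hV := lift_valid e h.1
  have hleft : ∀ a b, (net e).InX ⟨a, b, true⟩ →
      ((net e).step (lift e D) ^ (net e).n) ⟨a, b, true⟩ = (net e).g ⟨a, b, true⟩ := by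
    intro a b hx
    obtain ⟨a₀, h1, h2, h3, h4⟩ := (net e).exists_dart (D := lift e D) hx
    refine (net e).close_of_pow hV ?_ _ h4
    have hb : a₀ < b ∧ b < a₀ + P.V.card := by
      rw [PNet.inX_left, net_n] at h3
      have := (net e).lt_nx b
      have := (net e).pv_lt b
      omega
    have hd := (dart_inX e hV hb.1 hb.2).mpr ⟨h2, h3⟩
    rw [← dart_iff e hb.1 hb.2] at hd
    obtain ⟨S, hS, hSe⟩ := h.2.2.2.1 _ hd
    obtain ⟨hst, hsub⟩ := h.2.1 S hS
    obtain ⟨k, p, st⟩ := exists_starIx e hst hsub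
    obtain ⟨i, hi⟩ := st.of_edge _ hSe
    rw [Prod.mk.injEq] at hi
    obtain ⟨m, hm⟩ := e.q_eq_iff.mp hi.1
    have hper : ∀ (m i : ℤ), p (i + m * (2 * k + 1)) = p i + m * P.V.card := by
      intro m
      induction m using Int.induction_on with
      | zero => simp
      | succ m ih =>
        intro i
        rw [show i + ((m : ℤ) + 1) * (2 * k + 1) = i + m * (2 * k + 1) + (2 * k + 1) by ring, st.per,
          ih]; ring
      | pred m ih =>
        intro i
        have := st.per (i + (-(m : ℤ) - 1) * (2 * k + 1))
        rw [show i + (-(m : ℤ) - 1) * (2 * k + 1) + (2 * k + 1) = i + -m * (2 * k + 1) by ring, ih]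
          at this
        linarith
    have ha : a₀ = p (i + m * (2 * k + 1)) := by rw [hper]; exact hm
    have hb' : b = p (i + m * (2 * k + 1) + k) := by
      have bb := st.bounds e (i + m * (2 * k + 1))
      rw [← ha] at bb
      refine e.lift_unique hb.1 hb.2.le bb.1 bb.2.le ?_
      rw [show i + m * (2 * k + 1) + k = i + k + m * (2 * k + 1) by ring, hper, e.q_mul]; exact hi.2
    have := star_close e h hS st (i + m * (2 * k + 1))
    rw [← ha, ← hb'] at this
    exact this
  refine ⟨hV, ?_⟩
  rintro ⟨a, b, d⟩ hx
  cases d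
  · have h1 := hleft (b - (net e).n) a ((net e).inX_g.mpr hx)
    have h2 := (net e).zpow_g hV (net e).n ⟨a, b, false⟩
    rw [zpow_natCast] at h2
    exact (net e).g.injective (h2.symm.trans h1)
  · exact hleft a b hx

end CyclicPolygon

namespace PNet
variable (N : PNet) {D : Set (ℤ × ℤ)}

/-- the strand through `x` -/
def O (D : Set (ℤ × ℤ)) (x : PSt) : Set PSt := {y | ∃ m : ℤ, y = (N.step D ^ m) x}

lemma self_mem_O (x : PSt) : x ∈ N.O D x := ⟨0, by simp⟩

lemma O_zpow {x y : PSt} (hy : y ∈ N.O D x) (m : ℤ) : (N.step D ^ m) y ∈ N.O D x := by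
  obtain ⟨k, rfl⟩ := hy
  exact ⟨m + k, by rw [zpow_add, Equiv.Perm.mul_apply]⟩

lemma O_pow {x y : PSt} (hy : y ∈ N.O D x) (m : ℕ) : (N.step D ^ m) y ∈ N.O D x := by
  have := N.O_zpow hy m; rwa [zpow_natCast] at this

lemma O_pow_iff {x y z : PSt} (m : ℕ) (h : (N.step D ^ m) y = z) :
    z ∈ N.O D x ↔ y ∈ N.O D x := by
  constructor
  · intro hz
    have := N.O_zpow hz (-m)
    rwa [← h, ← zpow_natCast, ← Equiv.Perm.mul_apply, ← zpow_add, neg_add_cancel, zpow_zero] at this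
  · intro hy; rw [← h]; exact N.O_pow hy m

lemma O_eq {x y : PSt} (hy : y ∈ N.O D x) : N.O D y = N.O D x := by
  ext z
  constructor
  · rintro ⟨m, rfl⟩; exact N.O_zpow hy m
  · rintro ⟨m, rfl⟩
    obtain ⟨k, rfl⟩ := hy
    exact ⟨m - k, by rw [← Equiv.Perm.mul_apply, ← zpow_add, sub_add_cancel]⟩

lemma O_inX (hg : N.Good D) {x y : PSt} (hx : N.InX x) (hy : y ∈ N.O D x) : N.InX y := by
  obtain ⟨m, rfl⟩ := hy
  exact N.inX_zpow hg.toValid hx m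

lemma O_g (hg : N.Good D) {x : PSt} (hx : N.InX x) (y : PSt) :
    N.g y ∈ N.O D x ↔ y ∈ N.O D x := by
  constructor
  · intro h
    have hy : N.InX y := N.inX_g.mp (N.O_inX hg hx h)
    rwa [N.O_pow_iff N.n (hg.close y hy)] at h
  · intro h
    rwa [N.O_pow_iff N.n (hg.close y (N.O_inX hg hx h))]

lemma O_shift1 (hg : N.Good D) {x : PSt} (hx : N.InX x) (a b : ℤ) (d : Bool) :
    ⟨a + N.n, b + N.n, d⟩ ∈ N.O D x ↔ ⟨a, b, d⟩ ∈ N.O D x := by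
  rw [← N.O_g hg hx, ← N.O_g hg hx]
  have : N.g (N.g ⟨a + N.n, b + N.n, d⟩) = ⟨a, b, d⟩ := by ext <;> simp
  rw [this]

lemma O_shift (hg : N.Good D) {x : PSt} (hx : N.InX x) (m a b : ℤ) (d : Bool) :
    ⟨a + m * N.n, b + m * N.n, d⟩ ∈ N.O D x ↔ ⟨a, b, d⟩ ∈ N.O D x := by
  induction m using Int.induction_on generalizing a b with
  | zero => simp
  | succ m ih =>
    rw [← ih a b]
    rw [show a + ((m : ℤ) + 1) * N.n = a + m * N.n + N.n by ring,
      show b + ((m : ℤ) + 1) * N.n = b + m * N.n + N.n by ring, N.O_shift1 hg hx]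
  | pred m ih =>
    rw [← ih a b, ← N.O_shift1 hg hx]
    rw [show a + (-(m : ℤ) - 1) * N.n + N.n = a + -m * N.n by ring,
      show b + (-(m : ℤ) - 1) * N.n + N.n = b + -m * N.n by ring]

lemma K_shift (hv : N.Valid D) (m a b : ℤ) :
    (a + m * N.n, b + m * N.n) ∈ N.K D ↔ (a, b) ∈ N.K D := by
  rw [← N.inv_zpow (N.K_inv hv) (2 * m), N.gp_even]; simp

lemma mem_g (hg : N.Good D) {x : PSt} (hx : N.InX x) (a b : ℤ) (d : Bool) :
    ⟨b - N.n, a, !d⟩ ∈ N.O D x ↔ ⟨a, b, d⟩ ∈ N.O D x := N.O_g hg hx ⟨a, b, d⟩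

lemma mem_K_g (hv : N.Valid D) (a b : ℤ) : (b - (N.n : ℤ), a) ∈ N.K D ↔ (a, b) ∈ N.K D :=
  N.K_inv hv (a, b)

lemma O_cmp {x y z : PSt} (hy : y ∈ N.O D x) (hz : z ∈ N.O D x) :
    (∃ m : ℕ, z = (N.step D ^ m) y) ∨ (∃ m : ℕ, 0 < m ∧ y = (N.step D ^ m) z) := by
  rw [← N.O_eq hy] at hz
  obtain ⟨m, rfl⟩ := hz
  obtain ⟨k, rfl | rfl⟩ := m.eq_nat_or_neg
  · left; exact ⟨k, by rw [zpow_natCast]⟩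
  · rcases Nat.eq_zero_or_pos k with rfl | hk
    · left; exact ⟨0, by simp⟩
    · right
      refine ⟨k, hk, ?_⟩
      rw [← zpow_natCast, ← Equiv.Perm.mul_apply, ← zpow_add]; simp

lemma step_mono (y : PSt) : (N.step D y).a ≤ y.a ∧ (N.step D y).b ≤ y.b := by
  obtain ⟨a, b, d⟩ := y
  cases d
  · rw [step_down]; simp
  · rw [step_left]; simp

lemma pow_mono (y : PSt) (m : ℕ) : ((N.step D ^ m) y).a ≤ y.a ∧ ((N.step D ^ m) y).b ≤ y.b := by
  induction m with
  | zero => simp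
  | succ m ih =>
    rw [pow_succ_step]
    have := N.step_mono (D := D) ((N.step D ^ m) y)
    omega

lemma pow_mono' (y : PSt) {i j : ℕ} (h : i ≤ j) : ((N.step D ^ j) y).a ≤ ((N.step D ^ i) y).a ∧
    ((N.step D ^ j) y).b ≤ ((N.step D ^ i) y).b := by
  obtain ⟨k, rfl⟩ := Nat.exists_eq_add_of_le h
  have := N.pow_mono (D := D) ((N.step D ^ i) y) k
  rwa [← Equiv.Perm.mul_apply, ← pow_add, add_comm k i] at this

lemma pow_down {a b : ℤ} {m : ℕ} (hm : 0 < m) : ((N.step D ^ m) ⟨a, b, false⟩).b < b := by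
  have := (N.pow_mono' (D := D) ⟨a, b, false⟩ (show 1 ≤ m from hm)).2
  rw [pow_one, step_down] at this
  simp only at this; omega

lemma pow_left {a b : ℤ} {m : ℕ} (hm : 0 < m) : ((N.step D ^ m) ⟨a, b, true⟩).a < a := by
  have := (N.pow_mono' (D := D) ⟨a, b, true⟩ (show 1 ≤ m from hm)).1
  rw [pow_one, step_left] at this
  simp only at this; omega

lemma pred_left {w : PSt} {a b : ℤ} (h : N.step D w = ⟨a, b, true⟩) :
    w = if (a, b) ∈ N.K D then ⟨a, b + 1, false⟩ else ⟨a + 1, b, true⟩ := by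
  obtain ⟨a', b', d⟩ := w
  cases d
  · rw [step_down, PSt.mk.injEq] at h
    obtain ⟨rfl, rfl, h⟩ := h
    have : (a', b' - 1) ∈ N.K D := by by_contra hc; rw [if_neg hc] at h; cases h
    rw [if_pos this, sub_add_cancel]
  · rw [step_left, PSt.mk.injEq] at h
    obtain ⟨rfl, rfl, h⟩ := h
    have : (a' - 1, b') ∉ N.K D := by intro hc; rw [if_pos hc] at h; cases h
    rw [if_neg this, sub_add_cancel]

lemma pred_down {w : PSt} {a b : ℤ} (h : N.step D w = ⟨a, b, false⟩) :
    w = if (a, b) ∈ N.K D then ⟨a + 1, b, true⟩ else ⟨a, b + 1, false⟩ := by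
  obtain ⟨a', b', d⟩ := w
  cases d
  · rw [step_down, PSt.mk.injEq] at h
    obtain ⟨rfl, rfl, h⟩ := h
    have : (a', b' - 1) ∉ N.K D := by intro hc; rw [if_pos hc] at h; cases h
    rw [if_neg this, sub_add_cancel]
  · rw [step_left, PSt.mk.injEq] at h
    obtain ⟨rfl, rfl, h⟩ := h
    have : (a' - 1, b') ∈ N.K D := by by_contra hc; rw [if_neg hc] at h; cases h
    rw [if_pos this, sub_add_cancel]

section strand
variable {x : PSt}

lemma row_path {a b c : ℤ} (hy : ⟨a, b, true⟩ ∈ N.O D x) (hz : ⟨c, b, false⟩ ∈ N.O D x) :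
    ∃ m : ℕ, 0 < m ∧ c = a - m ∧ (∀ j < m, (N.step D ^ j) ⟨a, b, true⟩ = ⟨a - j, b, true⟩) ∧
      (N.step D ^ m) ⟨a, b, true⟩ = ⟨c, b, false⟩ := by
  rcases N.O_cmp hy hz with ⟨m, hm⟩ | ⟨m, hm0, hm⟩
  · have hm0 : 0 < m := by
      rcases Nat.eq_zero_or_pos m with rfl | h
      · simp at hm
      · exact h
    have key : ∀ j ≤ m, ((N.step D ^ j) ⟨a, b, true⟩).b = b ∧
        ((N.step D ^ j) ⟨a, b, true⟩).a = a - j := by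
      intro j hj
      have h1 := (N.pow_mono' (D := D) ⟨a, b, true⟩ hj).2
      have h2 := (N.pow_mono (D := D) ⟨a, b, true⟩ j).2
      have h3 := N.time_pow D ⟨a, b, true⟩ j
      rw [← hm] at h1
      simp only [PSt.time] at h1 h2 h3
      omega
    refine ⟨m, hm0, ?_, ?_, hm.symm⟩
    · have := (key m le_rfl).2; rw [← hm] at this; exact this
    · intro j hj
      obtain ⟨k1, k2⟩ := key j hj.le
      obtain ⟨k3, k4⟩ := key (j + 1) hj
      rw [pow_succ_step] at k3
      generalize (N.step D ^ j) ⟨a, b, true⟩ = w at *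
      obtain ⟨a', b', d⟩ := w
      cases d
      · rw [step_down] at k3; simp only at k1 k3; omega
      · simp only at k1 k2; rw [k1, k2]
  · have := N.pow_down (D := D) (a := c) (b := b) hm0
    rw [← hm] at this; simp at this

lemma row_lt {a b c : ℤ} (hy : ⟨a, b, true⟩ ∈ N.O D x) (hz : ⟨c, b, false⟩ ∈ N.O D x) : c < a := by
  obtain ⟨m, h1, h2, -⟩ := N.row_path hy hz; omega

lemma row_mid {a b c d : ℤ} (hy : ⟨a, b, true⟩ ∈ N.O D x) (hz : ⟨c, b, false⟩ ∈ N.O D x)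
    (h1 : c < d) (h2 : d < a) : (d, b) ∉ N.K D ∧ ⟨d, b, true⟩ ∈ N.O D x := by
  obtain ⟨m, m1, m2, m3, m4⟩ := N.row_path hy hz
  obtain ⟨j, hj⟩ : ∃ j : ℕ, a - d = j + 1 := ⟨(a - d - 1).toNat, by omega⟩
  have e1 := m3 (j + 1) (by omega)
  have e2 := e1
  rw [pow_succ_step, m3 j (by omega), step_left, PSt.mk.injEq] at e1
  have : a - (j : ℤ) - 1 = d := by omega
  rw [this] at e1
  constructor
  · intro hc; rw [if_pos hc] at e1; cases e1.2.2
  · have := N.O_pow hy (j + 1)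
    rw [e2, show a - ((j + 1 : ℕ) : ℤ) = d by push_cast; omega] at this
    exact this

lemma row_no_col {a b c d y : ℤ} (hy : ⟨a, b, true⟩ ∈ N.O D x) (hz : ⟨c, b, false⟩ ∈ N.O D x)
    (h1 : c < d) (h2 : d < a) : ⟨d, y, false⟩ ∉ N.O D x := by
  intro ht
  obtain ⟨hk, hw⟩ := N.row_mid hy hz h1 h2
  rcases N.O_cmp ht hw with ⟨m, hm⟩ | ⟨m, hm0, hm⟩
  · rcases m with _ | m
    · simp at hm
    · rw [pow_succ_step] at hm
      have := N.pred_left hm.symm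
      rw [if_neg hk] at this
      have h3 := (N.pow_mono (D := D) ⟨d, y, false⟩ m).1
      rw [this] at h3; simp only at h3; omega
  · have := N.pow_left (D := D) (a := d) (b := b) hm0
    rw [← hm] at this; simp at this

lemma dart_unique {a a' b : ℤ} (hy : ⟨a, b, true⟩ ∈ N.O D x) (hy' : ⟨a', b, true⟩ ∈ N.O D x)
    (hk : (a, b) ∈ N.K D) (hk' : (a', b) ∈ N.K D) : a = a' := by
  have key : ∀ a a', (a', b) ∈ N.K D → ∀ m, ⟨a', b, true⟩ = (N.step D ^ m) ⟨a, b, true⟩ →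
      a = a' := by
    intro a a' hk' m hm
    rcases m with _ | m
    · simp at hm; exact hm.symm
    · rw [pow_succ_step] at hm
      have := N.pred_left hm.symm
      rw [if_pos hk'] at this
      have h3 := (N.pow_mono (D := D) ⟨a, b, true⟩ m).2
      rw [this] at h3; simp only at h3; omega
  rcases N.O_cmp hy hy' with ⟨m, hm⟩ | ⟨m, hm0, hm⟩
  · exact key a a' hk' m hm
  · exact (key a' a hk m hm).symm

lemma exit_unique {c c' b : ℤ} (hy : ⟨c, b, false⟩ ∈ N.O D x) (hy' : ⟨c', b, false⟩ ∈ N.O D x) 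
    (hk : (c, b) ∈ N.K D) (hk' : (c', b) ∈ N.K D) : c = c' := by
  have key : ∀ c c', (c', b) ∈ N.K D → ∀ m, ⟨c', b, false⟩ = (N.step D ^ m) ⟨c, b, false⟩ →
      c = c' := by
    intro a a' hk' m hm
    rcases m with _ | m
    · simp at hm; exact hm.symm
    · have := N.pow_down (D := D) (a := a) (b := b) (Nat.succ_pos m)
      rw [← hm] at this; simp at this
  rcases N.O_cmp hy hy' with ⟨m, hm⟩ | ⟨m, hm0, hm⟩
  · exact key c c' hk' m hm
  · exact (key c' c hk m hm).symm

lemma exists_exit (hg : N.Good D) (hx : N.InX x) {a b : ℤ} (hy : ⟨a, b, true⟩ ∈ N.O D x) :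
    ∃ c, ⟨c, b, false⟩ ∈ N.O D x ∧ (c, b) ∈ N.K D := by
  have h1 := N.O_inX hg hx hy
  rw [inX_left] at h1
  have hk : (N.nx b - N.n, b) ∈ N.K D := by
    right; right; rw [N.eq_pv_iff]; simp
  obtain ⟨c, ⟨h2, h3⟩, h4⟩ := Int.exists_greatest_of_bdd (P := fun c => c < a ∧ (c, b) ∈ N.K D)
    ⟨a, fun z hz => hz.1.le⟩ ⟨N.nx b - N.n, by omega, hk⟩
  refine ⟨c, ?_, h3⟩
  refine (N.O_pow_iff _ (N.row_turn h2 ?_ h3)).mpr hy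
  intro c' h5 h6 h7
  have := h4 c' ⟨h6, h7⟩
  omega

lemma exists_entry (hg : N.Good D) (hx : N.InX x) {a b : ℤ} (hy : ⟨a, b, true⟩ ∈ N.O D x) :
    ∃ a₀, ⟨a₀, b, true⟩ ∈ N.O D x ∧ (a₀, b) ∈ N.K D := by
  obtain ⟨a₀, h1, h2, h3, h4⟩ := N.exists_dart (D := D) (N.O_inX hg hx hy)
  exact ⟨a₀, (N.O_pow_iff _ h4).mp hy, h2⟩

lemma row_of_exit {c b : ℤ} (hz : ⟨c, b, false⟩ ∈ N.O D x) (hk : (c, b) ∈ N.K D) :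
    ⟨c + 1, b, true⟩ ∈ N.O D x := by
  have h1 := N.O_zpow hz (-1)
  have h2 : N.step D ((N.step D ^ (-1 : ℤ)) ⟨c, b, false⟩) = ⟨c, b, false⟩ := by
    rw [zpow_neg_one]; exact perm_apply_inv _ _
  rw [N.pred_down h2, if_pos hk] at h1
  exact h1

end strand

lemma inX_bounds {a b : ℤ} (h : N.InX ⟨a, b, true⟩) : a < b ∧ b < a + N.n := by
  rw [inX_left] at h
  have := N.lt_nx b
  have := N.pv_lt b
  omega

end PNet

namespace CyclicPolygon
variable {P : CyclicPolygon} (e : CEnum P.V) {Dl : Set (ℤ × ℤ)}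

def Ed (Dl : Set (ℤ × ℤ)) (x : PSt) (u v : ℂ) : Prop :=
  ∃ a b, ⟨a, b, true⟩ ∈ (net e).O Dl x ∧ (a, b) ∈ (net e).K Dl ∧ u = e.q a ∧ v = e.q b

def Rw (Dl : Set (ℤ × ℤ)) (x : PSt) (z : ℂ) : Prop :=
  ∃ c a, ⟨a, c, true⟩ ∈ (net e).O Dl x ∧ z = e.q c

section
variable (hg : (net e).Good Dl) {x : PSt} (hx : (net e).InX x)
include hg hx

lemma ed_out {c : ℤ} {w : ℂ} (h : Ed e Dl x (e.q c) w) :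
    ∃ b, ⟨c, b, true⟩ ∈ (net e).O Dl x ∧ (c, b) ∈ (net e).K Dl ∧ w = e.q b := by
  obtain ⟨a, b, h1, h2, h3, rfl⟩ := h
  obtain ⟨m, rfl⟩ := e.q_eq_iff.mp h3
  refine ⟨b + m * P.V.card, ?_, ?_, (e.q_mul _ _).symm⟩
  · exact ((net e).O_shift hg hx m a b true).mpr h1
  · exact ((net e).K_shift hg.toValid m a b).mpr h2

lemma ed_in {c : ℤ} {w : ℂ} (h : Ed e Dl x w (e.q c)) :
    ∃ a, ⟨a, c, true⟩ ∈ (net e).O Dl x ∧ (a, c) ∈ (net e).K Dl ∧ w = e.q a := by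
  obtain ⟨a, b, h1, h2, rfl, h3⟩ := h
  obtain ⟨m, rfl⟩ := e.q_eq_iff.mp h3
  refine ⟨a + m * P.V.card, ?_, ?_, (e.q_mul _ _).symm⟩
  · exact ((net e).O_shift hg hx m a b true).mpr h1
  · exact ((net e).K_shift hg.toValid m a b).mpr h2

lemma rw_iff {c : ℤ} : Rw e Dl x (e.q c) ↔ ∃ a, ⟨a, c, true⟩ ∈ (net e).O Dl x := by
  constructor
  · rintro ⟨c', a, h1, h2⟩
    obtain ⟨m, rfl⟩ := e.q_eq_iff.mp h2
    exact ⟨a + m * P.V.card, ((net e).O_shift hg hx m a c' true).mpr h1⟩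
  · rintro ⟨a, h⟩; exact ⟨c, a, h, rfl⟩

/-- a dart seen as an exit of the row of its tail -/
lemma dart_exit {a b : ℤ} : (⟨a, b, true⟩ ∈ (net e).O Dl x ∧ (a, b) ∈ (net e).K Dl) ↔
    (⟨b - P.V.card, a, false⟩ ∈ (net e).O Dl x ∧ (b - (P.V.card : ℤ), a) ∈ (net e).K Dl) := by
  have h1 := (net e).mem_g hg hx a b true
  have h2 := (net e).mem_K_g hg.toValid a b
  rw [net_n] at h1 h2
  rw [h2, ← h1]; rfl

lemma ed_iff {a b : ℤ} (h1 : a < b) (h2 : b < a + P.V.card) :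
    Ed e Dl x (e.q a) (e.q b) ↔ ⟨a, b, true⟩ ∈ (net e).O Dl x ∧ (a, b) ∈ (net e).K Dl := by
  constructor
  · intro h
    obtain ⟨b', h3, h4, h5⟩ := ed_out e hg hx h
    have h6 := (net e).inX_bounds ((net e).O_inX hg hx h3)
    rw [net_n] at h6
    have : b = b' := e.lift_unique h1 h2.le h6.1 h6.2.le h5
    subst this; exact ⟨h3, h4⟩
  · rintro ⟨h3, h4⟩; exact ⟨a, b, h3, h4, rfl, rfl⟩

lemma ed_next {a b c : ℤ} (h1 : ⟨a, b, true⟩ ∈ (net e).O Dl x) 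
    (h3 : ⟨b, c, true⟩ ∈ (net e).O Dl x) (h4 : (b, c) ∈ (net e).K Dl) : c < a + P.V.card := by
  have h5 := (dart_exit e hg hx).mp ⟨h3, h4⟩
  have := (net e).row_lt h1 h5.1
  omega

end

lemma cp_ext {S T : CyclicPolygon} (h1 : S.V = T.V) (h2 : S.E = T.E) : S = T := by
  cases S; cases T; simp only at h1 h2; subst h1 h2; rfl

/-- the cyclic polygon of a strand -/
def poly (hg : (net e).Good Dl) {x : PSt} (hx : (net e).InX x) : CyclicPolygon where
  V := P.V.filter (fun z => Rw e Dl x z)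
  E := (P.V ×ˢ P.V).filter (fun z => Ed e Dl x z.1 z.2)
  nonempty := by
    obtain ⟨a, b, h⟩ : ∃ a b, ⟨a, b, true⟩ ∈ (net e).O Dl x := by
      obtain ⟨a, b, d⟩ := x
      cases d
      · exact ⟨b - (net e).n, a, ((net e).mem_g hg hx a b false).mpr ((net e).self_mem_O _)⟩
      · exact ⟨a, b, (net e).self_mem_O _⟩
    exact ⟨e.q b, Finset.mem_filter.mpr ⟨e.q_mem b, b, a, h, rfl⟩⟩
  onCircle := fun v hv => P.onCircle v (Finset.mem_filter.mp hv).1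
  endmem := by
    rintro ⟨u, v⟩ h
    obtain ⟨h1, h2⟩ := Finset.mem_filter.mp h
    rw [Finset.mem_product] at h1
    obtain ⟨a, b, h3, h4, h5, h6⟩ := h2
    simp only at h5 h6 h1 ⊢
    subst h5 h6
    refine ⟨Finset.mem_filter.mpr ⟨h1.1, ?_⟩, Finset.mem_filter.mpr ⟨h1.2, b, a, h3, rfl⟩⟩
    obtain ⟨h7, h8⟩ := (dart_exit e hg hx).mp ⟨h3, h4⟩
    exact ⟨a, _, (net e).row_of_exit h7 h8, rfl⟩
  outdeg := by
    intro v hv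
    obtain ⟨h1, c, a, h2, rfl⟩ := Finset.mem_filter.mp hv
    obtain ⟨d, h3, h4⟩ := (net e).exists_exit hg hx h2
    have h5 := (dart_exit e hg hx (a := c) (b := d + P.V.card)).mpr (by simpa using ⟨h3, h4⟩)
    refine ⟨e.q (d + P.V.card), ?_, ?_⟩
    · exact Finset.mem_filter.mpr ⟨Finset.mem_product.mpr ⟨h1, e.q_mem _⟩, c, _, h5.1, h5.2, rfl, rfl⟩
    · intro w hw
      obtain ⟨b, h6, h7, rfl⟩ := ed_out e hg hx (Finset.mem_filter.mp hw).2
      have h8 := (dart_exit e hg hx).mp ⟨h6, h7⟩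
      have := (net e).exit_unique h3 h8.1 h4 h8.2
      rw [this, sub_add_cancel]
  indeg := by
    intro v hv
    obtain ⟨h1, c, a, h2, rfl⟩ := Finset.mem_filter.mp hv
    obtain ⟨d, h3, h4⟩ := (net e).exists_entry hg hx h2
    refine ⟨e.q d, ?_, ?_⟩
    · exact Finset.mem_filter.mpr ⟨Finset.mem_product.mpr ⟨e.q_mem _, h1⟩, d, _, h3, h4, rfl, rfl⟩
    · intro w hw
      obtain ⟨b, h6, h7, rfl⟩ := ed_in e hg hx (Finset.mem_filter.mp hw).2
      rw [(net e).dart_unique h3 h6 h4 h7]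
  acw := by
    intro u v w huv hvw
    obtain ⟨a, b, h1, h2, rfl, rfl⟩ := (Finset.mem_filter.mp huv).2
    obtain ⟨c, h3, h4, rfl⟩ := ed_out e hg hx (Finset.mem_filter.mp hvw).2
    have b1 := (net e).inX_bounds ((net e).O_inX hg hx h1)
    have b2 := (net e).inX_bounds ((net e).O_inX hg hx h3)
    exact (e.acw_iff b1.1 b1.2 b2.1 b2.2).mpr (ed_next e hg hx h1 h3 h4)

section
variable (hg : (net e).Good Dl) {x : PSt} (hx : (net e).InX x)

lemma mem_polyE {u v : ℂ} : (u, v) ∈ (poly e hg hx).E ↔ Ed e Dl x u v := by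
  rw [poly, Finset.mem_filter, Finset.mem_product]
  constructor
  · exact fun h => h.2
  · rintro h
    refine ⟨?_, h⟩
    obtain ⟨a, b, -, -, rfl, rfl⟩ := h
    exact ⟨e.q_mem a, e.q_mem b⟩

lemma mem_polyV {u : ℂ} : u ∈ (poly e hg hx).V ↔ Rw e Dl x u := by
  rw [poly, Finset.mem_filter]
  constructor
  · exact fun h => h.2
  · rintro h
    refine ⟨?_, h⟩
    obtain ⟨a, b, -, rfl⟩ := h
    exact e.q_mem a

lemma polyV_sub : ((poly e hg hx).V : Set ℂ) ⊆ P.V := by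
  intro z hz
  exact (Finset.mem_filter.mp hz).1

lemma poly_congr {y : PSt} (hy : (net e).InX y) (h : y ∈ (net e).O Dl x) :
    poly e hg hy = poly e hg hx := by
  have := (net e).O_eq h
  refine cp_ext ?_ ?_
  · ext z; rw [mem_polyV, mem_polyV, Rw, Rw, this]
  · ext ⟨u, v⟩; rw [mem_polyE, mem_polyE, Ed, Ed, this]

lemma poly_isStar : IsStar (poly e hg hx) := by
  set S := poly e hg hx with hS
  obtain ⟨p, hp1, hp2, hp3⟩ := exists_sub e S S.en (polyV_sub e hg hx)
  set N := net S.en with hN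
  have hNn : (N.n : ℤ) = S.V.card := rfl
  have key : ∀ i, N.nx (N.nx i) = i + S.V.card - 1 := by
    intro i
    have g1 := N.lt_nx i
    have g2 := N.lt_nx (N.nx i)
    have g3 := N.acw (N.nx i)
    rw [N.pv_nx] at g3
    by_contra hc
    have hl1 : N.nx (N.nx i) < i + S.V.card - 1 := by omega
    have ed1 := nx_edge S.en i
    have ed2 := nx_edge S.en (N.nx i)
    rw [← hp3, ← hp3, mem_polyE] at ed1 ed2
    have lt1 := hp1 g1
    have lt2 := hp1 g2
    have lt3 : p (N.nx (N.nx i)) < p i + P.V.card := by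
      rw [← hp2]; exact hp1 g3
    rw [ed_iff e hg hx lt1 (by omega)] at ed1
    rw [ed_iff e hg hx lt2 (by omega)] at ed2
    have ex := (dart_exit e hg hx).mp ed2
    have hr : Rw e Dl x (e.q (p (i + S.V.card - 1))) := by
      rw [hp3, ← mem_polyV e hg hx]; exact S.en.q_mem _
    rw [rw_iff e hg hx] at hr
    obtain ⟨a, ha⟩ := hr
    have ha' := ((net e).mem_g hg hx _ _ _).mpr ha
    refine (net e).row_no_col ed1.1 ex.1 ?_ ?_ ha'
    · rw [net_n]
      have := hp1 hl1; omega
    · rw [net_n]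
      have : p (i + S.V.card - 1) < p (i + S.V.card) := hp1 (by omega)
      rw [hp2] at this; omega
  have hsh : ∀ i, N.nx (i - 1) = N.nx i - 1 := by
    intro i
    have h1 := key (N.nx i)
    rw [key i] at h1
    have h2 := N.nx_add (i - 1)
    rw [hNn, show i - 1 + (S.V.card : ℤ) = i + S.V.card - 1 by ring, h1] at h2
    omega
  have hk : ∀ i, N.nx i = i + N.nx 0 := by
    intro i
    induction i using Int.induction_on with
    | zero => simp
    | succ i ih =>
      have := hsh (i + 1)
      rw [add_sub_cancel_right] at this; omega
    | pred i ih => rw [hsh, ih]; ring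
  have h0 := N.lt_nx 0
  obtain ⟨k, hk0⟩ : ∃ k : ℕ, N.nx 0 = k := ⟨(N.nx 0).toNat, by omega⟩
  refine ⟨k, by omega, ?_, ?_⟩
  · have := key 0
    rw [hk] at this; omega
  · rintro ⟨u, v⟩ hz
    obtain ⟨i, -, -, rfl⟩ := S.en.exists_lift (S.mem_of_edge hz).1 0
    have hv := S.out_unique hz (nx_edge S.en i)
    have h2 := S.en.ncard_arc (N.lt_nx i) (nx_lt S.en i)
    have h3 : edgeLength S (S.en.q i) (S.en.q (N.nx i)) = k := by
      have h4 := hk i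
      have h5 : (((((S.V : Set ℂ) ∩ arcOO (S.en.q i) (S.en.q (N.nx i))).ncard : ℕ) : ℤ)) + 1 = N.nx i - i := h2
      rw [edgeLength]
      omega
    show edgeLength S (S.en.q i) v = k
    rw [hv]; exact h3

/-- set of all strand polygons -/
lemma polys_finite : {S | ∃ (x : PSt) (hx : (net e).InX x), S = poly e hg hx}.Finite := by
  have hinj : Function.Injective (fun S : CyclicPolygon => (S.V, S.E)) := by
    intro S T h
    rw [Prod.mk.injEq] at h
    exact cp_ext h.1 h.2
  refine Set.Finite.subset ((Finset.finite_toSet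
    (P.V.powerset ×ˢ (P.V ×ˢ P.V).powerset)).preimage hinj.injOn) ?_
  rintro S ⟨x, hx, rfl⟩
  rw [Set.mem_preimage, Finset.mem_coe, Finset.mem_product, Finset.mem_powerset,
    Finset.mem_powerset]
  exact ⟨Finset.filter_subset _ _, Finset.filter_subset _ _⟩

def polys : Finset CyclicPolygon := (polys_finite e hg).toFinset

lemma mem_polys {S : CyclicPolygon} : S ∈ polys e hg ↔ ∃ (x : PSt) (hx : (net e).InX x),
    S = poly e hg hx := by
  rw [polys, Set.Finite.mem_toFinset]; rfl

lemma poly_mem : poly e hg hx ∈ polys e hg := (mem_polys e hg).mpr ⟨x, hx, rfl⟩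

end

lemma edge_of_union {D : Set (Sym2 ℂ)} (hD : IsDiagonalSet P D) {u v : ℂ}
    (h : (u, v) ∈ (P.E : Set (ℂ × ℂ)) ∪ tilde D) : u ∈ P.V ∧ v ∈ P.V ∧ u ≠ v := by
  rcases h with h | h
  · exact ⟨(P.mem_of_edge h).1, (P.mem_of_edge h).2, P.edge_ne h⟩
  · have := hD _ _ h
    exact ⟨this.2.1.1, this.2.2.1, this.1⟩

lemma polys_decomp {D : Set (Sym2 ℂ)} (hD : IsDiagonalSet P D) (hg : (net e).Good (lift e D)) :
    IsStarDecomp P D (polys e hg) := by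
  refine ⟨hD, ?_, ?_, ?_, ?_, ?_⟩
  · intro S hS
    obtain ⟨x, hx, rfl⟩ := (mem_polys e hg).mp hS
    exact ⟨poly_isStar e hg hx, polyV_sub e hg hx⟩
  · intro S hS
    obtain ⟨x, hx, rfl⟩ := (mem_polys e hg).mp hS
    rintro ⟨u, v⟩ huv
    rw [Finset.mem_coe, mem_polyE] at huv
    obtain ⟨a, b, h1, h2, rfl, rfl⟩ := huv
    have h3 := (net e).O_inX hg hx h1
    have h4 := (net e).inX_bounds h3
    rw [dart_iff e h4.1 h4.2, dart_inX e hg.toValid h4.1 h4.2]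
    exact ⟨h2, h3⟩
  · rintro ⟨u, v⟩ huv
    obtain ⟨h1, h2, h3⟩ := edge_of_union hD huv
    obtain ⟨i, -, -, rfl⟩ := e.exists_lift h1 0
    obtain ⟨j, h4, h5, rfl⟩ := e.exists_lift' h2 i h3.symm
    rw [dart_iff e h4 h5, dart_inX e hg.toValid h4 h5] at huv
    refine ⟨_, poly_mem e hg huv.2, ?_⟩
    rw [mem_polyE]
    exact ⟨i, j, (net e).self_mem_O _, huv.1, rfl, rfl⟩
  · intro S₁ hS₁ S₂ hS₂ hne z h1 h2
    obtain ⟨x, hx, rfl⟩ := (mem_polys e hg).mp hS₁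
    obtain ⟨y, hy, rfl⟩ := (mem_polys e hg).mp hS₂
    apply hne
    obtain ⟨u, v⟩ := z
    rw [mem_polyE] at h1 h2
    obtain ⟨a, b, a1, a2, rfl, rfl⟩ := h1
    have h3 := (net e).O_inX hg hx a1
    have h4 := (net e).inX_bounds h3
    rw [ed_iff e hg hy h4.1 h4.2] at h2
    rw [← poly_congr e hg hx h3 a1, ← poly_congr e hg hy h3 h2.1]
  · rintro S hS u v w huv hvw ⟨z, hz, hsp⟩
    obtain ⟨x, hx, rfl⟩ := (mem_polys e hg).mp hS
    rw [mem_polyE] at huv hvw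
    obtain ⟨a, b, h1, h2, rfl, rfl⟩ := huv
    obtain ⟨c, h3, h4, rfl⟩ := ed_out e hg hx hvw
    have b1 := (net e).inX_bounds ((net e).O_inX hg hx h1)
    have b2 := (net e).inX_bounds ((net e).O_inX hg hx h3)
    have b3 := ed_next e hg hx h1 h3 h4
    rw [net_n] at b1 b2
    have hl := hD _ _ hz
    obtain ⟨d, d1, d2, rfl⟩ := e.exists_lift' hl.2.2.1 b hl.1.symm
    rw [SplitsAngle3, ← e.q_add a, e.splits_iff (by omega) (by omega) (by omega) d1 d2] at hsp
    obtain ⟨h5, h6⟩ := (dart_exit e hg hx).mp ⟨h3, h4⟩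
    refine ((net e).row_mid h1 h5 (d := d - P.V.card) (by omega) (by omega)).1 (Or.inl ⟨⟨?_, ?_⟩, ?_⟩)
    · simp only; omega
    · simp only; omega
    · rw [sv, e.q_sub, Sym2.eq_swap]; exact hz

end CyclicPolygon

namespace CyclicPolygon
variable {P : CyclicPolygon} (e : CEnum P.V)

lemma maxGood_lift {D : Set (Sym2 ℂ)} {𝒮 : Finset CyclicPolygon}
    (h : IsMaximalStarDecomp P D 𝒮) : (net e).MaxGood (lift e D) := by
  refine ⟨lift_good e h.1, fun D' hD' hg => ?_⟩
  have hdiag := back_diag e hg.toValid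
  have hlb := lift_back e hg.toValid
  have hg' : (net e).Good (lift e (back e D')) := by rw [hlb]; exact hg
  refine h.2 (back e D') ?_ ⟨_, polys_decomp e hdiag hg'⟩
  constructor
  · rw [← back_lift e h.1.1]; exact back_mono e hD'.1
  · intro hc
    apply hD'.2
    rw [← hlb]; exact lift_mono e hc

lemma maxDecomp {D : Set (Sym2 ℂ)} (hD : IsDiagonalSet P D) (hg : (net e).MaxGood (lift e D)) :
    IsMaximalStarDecomp P D (polys e hg.1) := by
  refine ⟨polys_decomp e hD hg.1, fun D' hD' ⟨𝒯, h𝒯⟩ => ?_⟩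
  refine hg.2 (lift e D') ⟨lift_mono e hD'.1, fun hc => hD'.2 ?_⟩ (lift_good e h𝒯)
  have := back_mono e hc
  rwa [back_lift e h𝒯.1, back_lift e hD] at this

lemma flips_back {D : Set (Sym2 ℂ)} (hD : IsDiagonalSet P D) (hg : (net e).MaxGood (lift e D))
    {D' : Set (ℤ × ℤ)} (h : Relation.ReflTransGen (net e).CFlip (lift e D) D') :
    ∃ (t : ℕ) (F : ℕ → Set (Sym2 ℂ)), F 0 = D ∧
      (∀ i ≤ t, IsDiagonalSet P (F i) ∧ (net e).MaxGood (lift e (F i))) ∧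
      (∀ i < t, FlipStep (F i) (F (i + 1))) ∧ lift e (F t) = D' := by
  induction h with
  | refl => exact ⟨0, fun _ => D, rfl, fun _ _ => ⟨hD, hg⟩, fun i hi => absurd hi (by omega), rfl⟩
  | @tail D₁ D₂ h1 h2 ih =>
    obtain ⟨t, F, f0, f1, f2, f3⟩ := ih
    obtain ⟨hm, p₁, p₂, a1, a2, a3, rfl⟩ := h2
    subst f3
    have hv := hm.1.toValid
    have hlb := lift_back e hv
    refine ⟨t + 1, fun i => if i ≤ t then F i else back e ((net e).tog (lift e (F t)) p₁ p₂),
      by simpa using f0, ?_, ?_, ?_⟩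
    · intro i hi
      by_cases hc : i ≤ t
      · simp only [if_pos hc]; exact f1 i hc
      · simp only [if_neg hc]
        exact ⟨back_diag e hv, by rw [hlb]; exact hm⟩
    · intro i hi
      rcases Nat.lt_succ_iff_lt_or_eq.mp hi with hc | rfl
      · simp only [if_pos hc.le, if_pos (Nat.succ_le_of_lt hc)]; exact f2 i hc
      · simp only [le_refl, if_true, if_neg (Nat.not_succ_le_self i)]
        have := flipStep_back e (f1 i le_rfl).2.1.toValid a1 a2 a3
        rwa [back_lift e (f1 i le_rfl).1] at this
    · simp only [if_neg (Nat.not_succ_le_self t)]; exact hlb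

lemma minimal_key {i₀ : ℤ} (h : MinimalEdge P (e.q i₀) (e.q ((net e).nx i₀))) (y : PSt)
    (hy : (net e).InX y) (ht : y.time = (⟨i₀, (net e).nx i₀, true⟩ : PSt).time) :
    (⟨i₀, (net e).nx i₀, true⟩ : PSt).key ≤ y.key := by
  have key : ∀ a, i₀ < a → (net e).nx a < (net e).nx i₀ → False := by
    intro a h1 h2
    have h3 := (net e).lt_nx a
    have h4 := nx_lt e a
    have h5 := nx_lt e i₀
    refine h.2 ⟨_, _, nx_edge e a, ?_⟩
    intro z hz hz'
    obtain ⟨c, c1, c2, rfl⟩ := e.exists_lift hz (a - 1)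
    rw [e.mem_arcCC h3 h4 (by omega) (by omega)] at hz'
    rw [e.mem_arcOO ((net e).lt_nx i₀) h5 (by omega) (by omega)]
    omega
  by_contra hc
  obtain ⟨a, b, d⟩ := y
  simp only [PSt.time] at ht
  cases d
  · rw [PNet.inX_down] at hy
    simp only [PSt.key, if_true] at hc
    simp only [Bool.false_eq_true, if_false] at hc
    rcases lt_trichotomy a i₀ with h1 | h1 | h1
    · omega
    · subst h1; omega
    · exact key a h1 (by omega)
  · rw [PNet.inX_left] at hy
    simp only [PSt.key, if_true] at hc
    refine key ((net e).pv b) (by omega) ?_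
    rw [(net e).nx_pv]; omega

lemma lex_map {k k' : ℕ} {f g : ℕ → ℝ}
    (h : List.Lex (· < ·) ((List.range k').map f) ((List.range k).map g)) :
    ∃ i ≤ k', (∀ j < i, f j = g j) ∧ ((i < k' ∧ i < k ∧ f i < g i) ∨ (i = k' ∧ k' < k)) := by
  have : (List.range k').map f < (List.range k).map g := h
  rw [List.lt_iff_exists] at this
  rcases this with ⟨h1, h2⟩ | ⟨i, h1, h2, h3, h4⟩
  · refine ⟨k', le_rfl, ?_, Or.inr ⟨rfl, by simpa using h2⟩⟩
    intro j hj
    have hl : k' < k := by simpa using h2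
    have := congrArg (fun l => l[j]?) h1
    simpa [hj, hj.trans hl, List.getElem?_take] using this
  · have h1' : i < k' := by simpa using h1
    have h2' : i < k := by simpa using h2
    simp only [List.getElem_map, List.getElem_range] at h3 h4
    exact ⟨i, h1'.le, h3, Or.inl ⟨h1', h2', h4⟩⟩

lemma StarIx.per_mul {S : CyclicPolygon} {k : ℕ} {p : ℤ → ℤ} (st : StarIx e S k p) (i m : ℤ) :
    p (i + m * (2 * k + 1)) = p i + m * P.V.card := by
  induction m using Int.induction_on with
  | zero => simp
  | succ m ih =>
    rw [show i + ((m : ℤ) + 1) * (2 * k + 1) = i + m * (2 * k + 1) + (2 * k + 1) by ring, st.per, ih]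
    ring
  | pred m ih =>
    have := st.per (i + (-(m : ℤ) - 1) * (2 * k + 1))
    rw [show i + (-(m : ℤ) - 1) * (2 * k + 1) + (2 * k + 1) = i + -(m : ℤ) * (2 * k + 1) by ring,
      ih] at this
    linarith

lemma StarIx.shift {S : CyclicPolygon} {k : ℕ} {p : ℤ → ℤ} (st : StarIx e S k p) (s : ℤ) :
    StarIx e S k (fun i => p (i + s)) where
  kpos := st.kpos
  card := st.card
  mono := fun i j h => st.mono (by omega)
  per := fun i => by
    rw [← st.per]; congr 1; ring
  edge := fun i => by
    have := st.edge (i + s)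
    rwa [show i + s + (k : ℤ) = i + k + s by ring] at this
  of_edge := fun z hz => by
    obtain ⟨i, hi⟩ := st.of_edge z hz
    refine ⟨i - s, ?_⟩
    rw [hi, sub_add_cancel, show i - s + k + s = i + k by ring]
  mem := fun z => by
    rw [st.mem]
    constructor
    · rintro ⟨i, rfl⟩; exact ⟨i - s, by rw [sub_add_cancel]⟩
    · rintro ⟨i, rfl⟩; exact ⟨_, rfl⟩

lemma exists_starIx_at {S : CyclicPolygon} (hS : IsStar S) (h : (S.V : Set ℂ) ⊆ P.V) {i j : ℤ}
    (h1 : i < j) (h2 : j < i + P.V.card) (hE : (e.q i, e.q j) ∈ S.E) :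
    ∃ (k : ℕ) (p : ℤ → ℤ), StarIx e S k p ∧ p 0 = i ∧ p k = j := by
  obtain ⟨k, p, st⟩ := exists_starIx e hS h
  obtain ⟨r, hr⟩ := st.of_edge _ hE
  rw [Prod.mk.injEq] at hr
  obtain ⟨m, hm⟩ := e.q_eq_iff.mp hr.1
  have st' := st.shift e (r + m * (2 * k + 1))
  have hp0 : p (0 + (r + m * (2 * k + 1))) = i := by
    rw [zero_add, st.per_mul, hm]
  refine ⟨k, _, st', hp0, ?_⟩
  have hb := st'.bounds e 0
  simp only [hp0, zero_add (k : ℤ)] at hb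
  refine e.lift_unique hb.1 hb.2.le h1 h2.le ?_
  rw [hr.2, ← add_assoc, st.per_mul, e.q_mul, add_comm (k : ℤ)]

end CyclicPolygon

namespace CyclicPolygon
variable {P : CyclicPolygon} (e : CEnum P.V)

section
variable {D : Set (Sym2 ℂ)} {𝒮 : Finset CyclicPolygon} (h : IsStarDecomp P D 𝒮)
  {S : CyclicPolygon} (hS : S ∈ 𝒮) {k : ℕ} {p : ℤ → ℤ} (st : StarIx e S k p)
include h hS st

lemma star_reach (j : ℕ) : ∃ m : ℕ, ((net e).step (lift e D) ^ m) ⟨p 0, p k, true⟩ =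
    ⟨p (-j), p (k - j), true⟩ := by
  induction j with
  | zero => exact ⟨0, by simp⟩
  | succ j ih =>
    obtain ⟨m, hm⟩ := ih
    obtain ⟨m1, h1⟩ := star_step e h hS st (-j)
    obtain ⟨m2, h2⟩ := star_step' e h hS st (-j)
    refine ⟨m2 + (m1 + m), ?_⟩
    rw [pow_add, pow_add, Equiv.Perm.mul_apply, Equiv.Perm.mul_apply, hm,
      show (k : ℤ) - j = -j + k by ring, h1, h2]
    push_cast
    rw [show -(j : ℤ) - 1 = -(j + 1) by ring, show -((j : ℤ) + 1) + k = k - (j + 1) by ring]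

lemma star_reach' (j : ℕ) : ∃ m : ℕ, ((net e).step (lift e D) ^ m) ⟨p 0, p k, true⟩ =
    ⟨p (-j - 1), p (k - j), false⟩ := by
  obtain ⟨m, hm⟩ := star_reach e h hS st j
  obtain ⟨m1, h1⟩ := star_step e h hS st (-j)
  refine ⟨m1 + m, ?_⟩
  rw [pow_add, Equiv.Perm.mul_apply, hm, show (k : ℤ) - j = -j + k by ring, h1]

lemma star_index {j m : ℕ} {y : ℤ} (hj : j < k) {d : Bool} (hy : p (k - j - 1) ≤ y)
    (hm : ((net e).step (lift e D) ^ m) ⟨p 0, p k, true⟩ = ⟨p (-j - 1), y, d⟩) :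
    m < (net e).n := by
  have h1 := congrArg PSt.time hm
  rw [PNet.time_pow] at h1
  simp only [PSt.time] at h1
  have h2 : p (-k - 1) + P.V.card = p k := by rw [← st.per]; congr 1; ring
  have h3 : p (-k - 1) < p (-j - 1) := st.mono (by omega)
  have h4 : p 0 ≤ p (k - j - 1) := st.mono.monotone (by omega)
  have : ((net e).n : ℤ) = P.V.card := rfl
  omega

lemma star_col {j : ℕ} {y : ℤ} (hy1 : p (k - j - 1) < y) (hy2 : y < p (k - j)) :
    (p (-j - 1), y) ∉ (net e).K (lift e D) ∧
    ∃ m : ℕ, ((net e).step (lift e D) ^ m) ⟨p 0, p k, true⟩ = ⟨p (-j - 1), y, false⟩ := by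
  have hfree : ∀ y, p (k - j - 1) < y → y < p (k - j) → (p (-j - 1), y) ∉ (net e).K (lift e D) := by
    intro y hy1 hy2
    have h1 := star_row_free e h hS st (k - j) y hy1 hy2
    rw [← (net e).mem_K_g (lift_valid e h.1)] at h1
    have h2 : p (-j - 1) + P.V.card = p (k - j + k) := by rw [← st.per]; congr 1; ring
    rwa [← h2, net_n, add_sub_cancel_right] at h1
  refine ⟨hfree y hy1 hy2, ?_⟩
  obtain ⟨m, hm⟩ := star_reach' e h hS st j
  obtain ⟨r, hr⟩ : ∃ r : ℕ, p (k - j) - y = r := ⟨(p (k - j) - y).toNat, by omega⟩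
  refine ⟨r + m, ?_⟩
  rw [pow_add, Equiv.Perm.mul_apply, hm, (net e).free_col r
    (fun c h1 h2 => hfree c (by omega) h2)]
  congr 1; omega

/-- the turning corners are boundary edges -/
lemma star_corner (hcor : ∀ j, 1 ≤ j → j ≤ (net e).n →
      ¬ ((((net e).step (lift e D) ^ (j - 1)) ⟨p 0, p k, true⟩).d = true ∧
        (((net e).step (lift e D) ^ j) ⟨p 0, p k, true⟩).d = false ∧
        (((net e).step (lift e D) ^ j) ⟨p 0, p k, true⟩).pos ∈ lift e D)) {j : ℕ} (hj : j < k) :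
    p (k - j) = (net e).pv (p (-j - 1)) + P.V.card := by
  obtain ⟨m, hm⟩ := star_reach' e h hS st j
  have hlt : m < (net e).n :=
    star_index e h hS st hj (st.mono.monotone (by omega)) hm
  have hper : p (k - j + k) = p (-j - 1) + P.V.card := by rw [← st.per]; congr 1; ring
  have b1 := st.bounds e (k - j)
  have b2 : p (-j - 1) < p (k - j) := st.mono (by omega)
  have hd : (e.q (p (k - j)), e.q (p (-j - 1))) ∈ (P.E : Set (ℂ × ℂ)) ∪ tilde D := by
    have := h.2.2.1 S hS (st.edge (k - j)); rwa [hper, e.q_add] at this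
  rw [dart_iff' e (by omega) (by omega)] at hd
  rcases hd with hd | hd
  · exact hd
  exfalso
  obtain ⟨m', rfl⟩ : ∃ m', m = m' + 1 := by
    rcases m with _ | m
    · have := congrArg PSt.d hm; simp at this
    · exact ⟨m, rfl⟩
  refine hcor (m' + 1) (by omega) (by omega) ⟨?_, ?_, ?_⟩
  · rw [PNet.pow_succ_step] at hm
    have := (net e).pred_down hm
    rw [if_pos (show _ ∈ (net e).K (lift e D) from Or.inl hd)] at this
    simp only [add_tsub_cancel_right, this]
  · rw [hm]
  · rw [hm]; exact hd

/-- down segments are tight -/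
lemma star_tight (hg : (net e).MaxGood (lift e D)) (hx : (net e).InX ⟨p 0, p k, true⟩)
    (hmin : ∀ y, (net e).InX y → y.time = (⟨p 0, p k, true⟩ : PSt).time →
      (⟨p 0, p k, true⟩ : PSt).key ≤ y.key) {j : ℕ} (hj : j < k) {y : ℤ}
    (hy2 : y < p (k - j)) (hy : y = (net e).nx (p (-j - 1)) ∨ (p (-j - 1), y) ∈ (net e).L) :
    y ≤ p (k - j - 1) := by
  by_contra hc
  push Not at hc
  obtain ⟨h1, m, hm⟩ := star_col e h hS st hc hy2
  rcases hy with hy | hy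
  · exact h1 (Or.inr (Or.inl hy))
  · obtain ⟨m', rfl⟩ : ∃ m', m = m' + 1 := by
      rcases m with _ | m
      · have := congrArg PSt.d hm; simp at this
      · exact ⟨m, rfl⟩
    have := star_index e h hS st hj hc.le hm
    exact (net e).no_cross_down hg hx hmin m' (by omega) hy (fun hd => h1 (Or.inl hd)) hm

end

def vsOf (k : ℕ) (p : ℤ → ℤ) (i : ℕ) : ℂ := e.q (p (i * k))

lemma vs_even {S : CyclicPolygon} {k : ℕ} {p : ℤ → ℤ} (st : StarIx e S k p) (j : ℕ) :
    vsOf e k p (2 * j) = e.q (p (-j)) := by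
  rw [vsOf, show ((2 * j : ℕ) : ℤ) * k = -j + j * (2 * k + 1) by push_cast; ring, st.per_mul, e.q_mul]

lemma vs_odd {S : CyclicPolygon} {k : ℕ} {p : ℤ → ℤ} (st : StarIx e S k p) (j : ℕ) :
    vsOf e k p (2 * j + 1) = e.q (p (k - j)) := by
  rw [vsOf, show ((2 * j + 1 : ℕ) : ℤ) * k = k - j + j * (2 * k + 1) by push_cast; ring,
    st.per_mul, e.q_mul]

lemma star_border {D : Set (Sym2 ℂ)} {𝒮 : Finset CyclicPolygon} (h : IsStarDecomp P D 𝒮)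
    (hg : (net e).MaxGood (lift e D)) {i₀ : ℤ}
    (hx : (net e).InX ⟨i₀, (net e).nx i₀, true⟩)
    (hmin : ∀ y, (net e).InX y → y.time = (⟨i₀, (net e).nx i₀, true⟩ : PSt).time →
      (⟨i₀, (net e).nx i₀, true⟩ : PSt).key ≤ y.key)
    (hcor : ∀ j, 1 ≤ j → j ≤ (net e).n →
      ¬ ((((net e).step (lift e D) ^ (j - 1)) ⟨i₀, (net e).nx i₀, true⟩).d = true ∧
        (((net e).step (lift e D) ^ j) ⟨i₀, (net e).nx i₀, true⟩).d = false ∧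
        (((net e).step (lift e D) ^ j) ⟨i₀, (net e).nx i₀, true⟩).pos ∈ lift e D)) :
    ∃ S ∈ 𝒮, IsBorderStar P (e.q ((net e).nx i₀)) S := by
  obtain ⟨S, hS, hSE⟩ := h.2.2.2.1 (e.q i₀, e.q ((net e).nx i₀)) (Or.inl (nx_edge e i₀))
  refine ⟨S, hS, ?_⟩
  have hprev := P.prev_eq (nx_edge e i₀)
  obtain ⟨hst, hsub⟩ := h.2.1 S hS
  obtain ⟨k, p, st, hp0, hpk⟩ := exists_starIx_at e hst hsub ((net e).lt_nx i₀) (nx_lt e i₀) hSE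
  rw [← hpk, ← hp0] at hprev
  rw [← hpk]
  rw [← hpk, ← hp0] at hx hmin hcor
  have hk := st.kpos
  have corner := fun {j : ℕ} => star_corner (j := j) e h hS st hcor
  have b0 : ∀ j : ℕ, j < k → p (-j - 1) < p (k - j - 1) ∧ p (k - j - 1) < p (k - j) ∧
      p (k - j) < p (-j - 1) + P.V.card := by
    intro j hj
    refine ⟨st.mono (by omega), st.mono (by omega), ?_⟩
    rw [← st.per]; exact st.mono (by omega)
  have vE := vs_even e st
  have vO := vs_odd e st
  have hedge : ∀ i : ℕ, (vsOf e k p i, vsOf e k p (i + 1)) ∈ S.E := by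
    intro i
    have := st.edge (i * k)
    rw [vsOf, vsOf]; push_cast; rwa [add_mul, one_mul]
  have hcE : ∀ j : ℕ, j < k → (vsOf e k p (2 * j + 1), vsOf e k p (2 * j + 2)) ∈ P.E := by
    intro j hj
    have := b0 j hj
    rw [vO, show 2 * j + 2 = 2 * (j + 1) by ring, vE]
    push_cast
    rw [show -((j : ℤ) + 1) = -j - 1 by ring, edge_iff' e (by omega) (by omega)]
    exact corner hj
  refine ⟨k, vsOf e k p, ⟨hk, hst, st.card, hsub, ?_, ?_, ?_, ?_, ?_, ?_, ?_⟩, ?_⟩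
  · rw [hprev, vsOf]; simp
  · rw [vsOf]; simp
  · rw [vO, vsOf]; simp
  · intro x hx
    obtain ⟨i, rfl⟩ := (st.mem x).mp hx
    obtain ⟨r, m, hr1, hr2, rfl⟩ : ∃ r m : ℤ, -k ≤ r ∧ r ≤ k ∧ i = r + m * (2 * k + 1) := by
      refine ⟨(i + k) % (2 * k + 1) - k, (i + k) / (2 * k + 1), ?_, ?_, ?_⟩
      · have := Int.emod_nonneg (i + k) (show (2 * k + 1 : ℤ) ≠ 0 by omega); omega
      · have := Int.emod_lt_of_pos (i + k) (show (0 : ℤ) < 2 * k + 1 by omega); omega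
      · have := Int.emod_add_mul_ediv (i + k) (2 * k + 1); linarith
    rw [st.per_mul, e.q_mul]
    rcases le_or_gt r 0 with h0 | h0
    · obtain ⟨j, rfl⟩ : ∃ j : ℕ, r = -j := ⟨(-r).toNat, by omega⟩
      exact ⟨2 * j, by omega, vE j⟩
    · obtain ⟨j, rfl⟩ : ∃ j : ℕ, r = k - j := ⟨(k - r).toNat, by omega⟩
      exact ⟨2 * j + 1, by omega, vO j⟩
  · exact fun i _ => hedge i
  · intro i _
    rcases h.2.2.1 S hS (hedge i) with h1 | h1
    · exact Or.inl h1
    · exact Or.inr (h.1 _ _ h1)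
  · intro i h1 h2
    obtain ⟨j, rfl⟩ : ∃ j, i = j + 1 := ⟨i - 1, by omega⟩
    exact hcE j (by omega)
  · rintro S' k' vs' ⟨hk', -, -, -, w0, w1, w2, -, -, w3, w4⟩ hlex
    -- comparison of a single angle
    have cmp : ∀ j : ℕ, j < k → j < k' → vs' (2 * j + 1) = vsOf e k p (2 * j + 1) →
        vangle (vsOf e k p (2 * j + 1)) (vsOf e k p (2 * j + 2)) (vsOf e k p (2 * j + 3)) ≤
          vangle (vs' (2 * j + 1)) (vs' (2 * j + 2)) (vs' (2 * j + 3)) ∧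
        (vangle (vs' (2 * j + 1)) (vs' (2 * j + 2)) (vs' (2 * j + 3)) =
          vangle (vsOf e k p (2 * j + 1)) (vsOf e k p (2 * j + 2)) (vsOf e k p (2 * j + 3)) →
          vs' (2 * j + 3) = vsOf e k p (2 * j + 3)) := by
      intro j hj hj' heq
      have e1 : vs' (2 * j + 2) = vsOf e k p (2 * j + 2) := by
        have := w4 (j + 1) (by omega) (by omega)
        rw [show 2 * (j + 1) - 1 = 2 * j + 1 by omega, heq] at this
        exact P.out_unique this (hcE j hj)
      obtain ⟨c1, c2, c3⟩ := b0 j hj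
      have o1 := vO j
      have o2 : vsOf e k p (2 * j + 2) = e.q (p (-j - 1)) := by
        have := vE (j + 1)
        push_cast at this
        rw [show 2 * j + 2 = 2 * (j + 1) by ring, this]; congr 2; ring
      have o3 : vsOf e k p (2 * j + 3) = e.q (p (k - j - 1)) := by
        have := vO (j + 1)
        push_cast at this
        rw [show 2 * j + 3 = 2 * (j + 1) + 1 by ring, this]; congr 2; ring
      have hw := w3 (2 * j + 2) (by omega)
      rw [show 2 * j + 2 + 1 = 2 * j + 3 by ring, e1, o2] at hw
      have hV : vs' (2 * j + 3) ∈ P.V ∧ vs' (2 * j + 3) ≠ e.q (p (-j - 1)) := by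
        rcases hw with hw | hw
        · exact ⟨(P.mem_of_edge hw).2, (P.edge_ne hw).symm⟩
        · exact ⟨hw.2.2.1, hw.1.symm⟩
      obtain ⟨y, y1, y2, y3⟩ := e.exists_lift' hV.1 (p (-j - 1)) hV.2
      rw [← y3, edge_iff e y1 y2, linkable_iff e y1 y2] at hw
      have hcor' := corner hj
      have y4 : y < p (k - j) := by
        rcases hw with hw | hw
        · have a1 := (net e).acw (p (-j - 1))
          rw [net_n] at a1
          omega
        · have := hw.2.1
          simp only [net_n] at this
          omega
      have y5 := star_tight e h hS st hg hx hmin hj y4 hw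
      rw [heq, e1, ← y3, o1, o2, o3, e.vangle_q (by omega) c3 c1 (by omega),
        e.vangle_q (by omega) c3 y1 y2]
      have m1 : e.θ y ≤ e.θ (p (k - j - 1)) := e.mono.monotone y5
      have m2 := e.mono c2
      rw [abs_of_pos (by linarith), abs_of_pos (by linarith)]
      refine ⟨by linarith, fun hh => ?_⟩
      have : e.θ y = e.θ (p (k - j - 1)) := by linarith
      rw [e.mono.injective this]
    obtain ⟨i, hi, heq, hcase⟩ := lex_map hlex
    have hik : i ≤ k := by rcases hcase with hc | hc <;> omega
    have agree : ∀ j ≤ i, vs' (2 * j + 1) = vsOf e k p (2 * j + 1) := by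
      intro j
      induction j with
      | zero =>
        intro _
        have := vO 0
        simp only [mul_zero, zero_add] at this ⊢
        rw [w1, this]; simp
      | succ j ih =>
        intro hj
        exact (cmp j (by omega) (by omega) (ih (by omega))).2 (heq j (by omega))
    rcases hcase with ⟨c1, c2, c3⟩ | ⟨rfl, c2⟩
    · exact absurd (cmp i c2 c1 (agree i le_rfl)).1 (not_le.mpr c3)
    · have := agree i le_rfl
      rw [w2, w0, hprev, vO] at this
      refine e.q_ne (st.mono (show (0 : ℤ) < k - i by omega)) ?_ this
      rw [← st.per]; exact st.mono (by omega)

end CyclicPolygon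

/-- Any maximal star decomposition of a cyclic polygon `P` with a minimal
edge `uv` can be transformed, by a finite sequence of diagonal flips, into a maximal star
decomposition containing the border star `S*(P, v)`. -/
theorem yield_border_star (P : CyclicPolygon) (D : Set (Sym2 ℂ)) (𝒮 : Finset CyclicPolygon)
    (h : IsMaximalStarDecomp P D 𝒮) (u v : ℂ) (hmin : MinimalEdge P u v) :
    ∃ (t : ℕ) (F : ℕ → Set (Sym2 ℂ)) (𝒮' : Finset CyclicPolygon),
      F 0 = D ∧
      (∀ i ≤ t, ∃ 𝒯 : Finset CyclicPolygon, IsMaximalStarDecomp P (F i) 𝒯) ∧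
      (∀ i < t, FlipStep (F i) (F (i + 1))) ∧
      IsMaximalStarDecomp P (F t) 𝒮' ∧
      ∃ S ∈ 𝒮', IsBorderStar P v S := by
  set e := P.en with he
  have huv := hmin.1
  obtain ⟨i₀, -, -, rfl⟩ := e.exists_lift (P.mem_of_edge huv).1 0
  have hv := P.out_unique huv (CyclicPolygon.nx_edge e i₀)
  subst hv
  have hx : (CyclicPolygon.net e).InX ⟨i₀, (CyclicPolygon.net e).nx i₀, true⟩ := by
    rw [PNet.inX_left]
    have h1 := (CyclicPolygon.net e).acw ((CyclicPolygon.net e).nx i₀)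
    rw [(CyclicPolygon.net e).pv_nx] at h1 ⊢
    exact ⟨h1, le_rfl⟩
  have hkey := CyclicPolygon.minimal_key e hmin
  have hmax := CyclicPolygon.maxGood_lift e h
  obtain ⟨D', hflip, hmax', hcor⟩ :=
    (CyclicPolygon.net e).flip_loop hmax hx hkey (CyclicPolygon.net e).n le_rfl
  obtain ⟨t, F, f0, f1, f2, rfl⟩ := CyclicPolygon.flips_back e h.1.1 hmax hflip
  have hfin := CyclicPolygon.maxDecomp e (f1 t le_rfl).1 hmax'
  refine ⟨t, F, CyclicPolygon.polys e hmax'.1, f0, ?_, f2, hfin, ?_⟩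
  · intro i hi
    exact ⟨_, CyclicPolygon.maxDecomp e (f1 i hi).1 (f1 i hi).2⟩
  · exact CyclicPolygon.star_border e hfin.1 hmax' hx hkey hcor

end
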